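/- arXiv:1110.1792 — 2 statements merged into one kernel-verified Lean document; each statement's English description precedes it below -/
import Mathlib

section
/- Let Γ ≤ Sim_L(ℝ^{m+2}) act freely, properly discontinuously and cocompactly on ℝ^{m+2}, and let P : Sim_L(ℝ^{m+2}) → O(m+1,1) be the projection sending the transformation x ↦ λAx + a to A. If P(Γ) is a discrete subgroup of O(m+1,1), then the intersection Δ = Γ ∩ (ℝ^{m+2} ⋊ ℝ^+) is a nontrivial group consisting entirely of pure translations (elements x ↦ x + a). -/
noncomputable section

/-- `Vec n` is the euclidean space `ℝ^n`. -/
abbrev Vec (n : ℕ) : Type := Fin n → ℝ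

/-- The group of invertible affine transformations of `ℝ^n`. -/
abbrev AffGroup (n : ℕ) := Vec n ≃ᵃ[ℝ] Vec n

/-- The standard Lorentz quadratic form `Q(x) = x₁² + ⋯ + x_{m+1}² − x_{m+2}²` on `ℝ^{m+2}`. -/
def lorentzQ (m : ℕ) (x : Vec (m + 2)) : ℝ :=
  (∑ i : Fin (m + 1), x i.castSucc ^ 2) - x (Fin.last (m + 1)) ^ 2

/-- Membership in the Lorentzian similarity group
`Sim_L(ℝ^{m+2}) = ℝ^{m+2} ⋊ (O(m+1,1) × ℝ^+)`: the linear part is `λ • A` with `λ > 0`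
and `A` a linear map preserving the Lorentz form. -/
def InSimL (m : ℕ) (g : AffGroup (m + 2)) : Prop :=
  ∃ (lam : ℝ) (A : Vec (m + 2) →ₗ[ℝ] Vec (m + 2)), 0 < lam ∧
    (∀ v, lorentzQ m (A v) = lorentzQ m v) ∧ ∀ v, g.linear v = lam • A v

/-- Properly discontinuous action on `ℝ^n`. -/
def ProperlyDisc {n : ℕ} (Γ : Subgroup (AffGroup n)) : Prop :=
  ∀ K : Set (Vec n), IsCompact K →
    {γ : AffGroup n | γ ∈ Γ ∧ (⇑γ '' K ∩ K).Nonempty}.Finite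

/-- Free action on `ℝ^n`. -/
def FreeAction {n : ℕ} (Γ : Subgroup (AffGroup n)) : Prop :=
  ∀ γ ∈ Γ, (∃ x : Vec n, γ x = x) → γ = 1

/-- Cocompact action on `ℝ^n`: some compact set meets every orbit. -/
def CocompactAction {n : ℕ} (Γ : Subgroup (AffGroup n)) : Prop :=
  ∃ K : Set (Vec n), IsCompact K ∧ ∀ x : Vec n, ∃ γ ∈ Γ, γ x ∈ K

/-- The image `P(Γ) ⊆ O(m+1,1)` of `Γ` under the projection
`P : Sim_L(ℝ^{m+2}) → O(m+1,1)`, realized as a set of matrices. -/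
def POfGamma (m : ℕ) (Γ : Subgroup (AffGroup (m + 2))) :
    Set (Matrix (Fin (m + 2)) (Fin (m + 2)) ℝ) :=
  {A | (∀ v, lorentzQ m (A.mulVec v) = lorentzQ m v) ∧
    ∃ γ ∈ Γ, ∃ lam : ℝ, 0 < lam ∧ ∀ v, γ.linear v = lam • A.mulVec v}

open Set Filter Topology MeasureTheory

/-- Families of functions that are polynomial in the parameter with continuous coefficients. -/
def PolyFam {n : ℕ} (h : ℝ → Vec n → ℝ) : Prop :=
  ∃ p : Polynomial C(Vec n, ℝ), ∀ t x, h t x = (p.eval (ContinuousMap.const _ t)) x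

theorem PolyFam.add {n : ℕ} {h k : ℝ → Vec n → ℝ} (hh : PolyFam h) (hk : PolyFam k) :
    PolyFam (fun t x => h t x + k t x) := by
  obtain ⟨p, hp⟩ := hh
  obtain ⟨q, hq⟩ := hk
  exact ⟨p + q, fun t x => by simp [hp, hq]⟩

theorem PolyFam.mul {n : ℕ} {h k : ℝ → Vec n → ℝ} (hh : PolyFam h) (hk : PolyFam k) :
    PolyFam (fun t x => h t x * k t x) := by
  obtain ⟨p, hp⟩ := hh
  obtain ⟨q, hq⟩ := hk
  exact ⟨p * q, fun t x => by simp [hp, hq]⟩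

theorem PolyFam.of_cont {n : ℕ} {f : Vec n → ℝ} (hf : Continuous f) :
    PolyFam (fun _ x => f x) :=
  ⟨Polynomial.C ⟨f, hf⟩, fun t x => by simp⟩

theorem PolyFam.param {n : ℕ} : PolyFam (fun t (_ : Vec n) => t) :=
  ⟨Polynomial.X, fun t x => by simp⟩

theorem PolyFam.pow {n : ℕ} {h : ℝ → Vec n → ℝ} (hh : PolyFam h) (k : ℕ) :
    PolyFam (fun t x => h t x ^ k) := by
  obtain ⟨p, hp⟩ := hh
  exact ⟨p ^ k, fun t x => by simp [hp]⟩

theorem PolyFam.sum {n : ℕ} {ι : Type*} (s : Finset ι) {h : ι → ℝ → Vec n → ℝ}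
    (hh : ∀ i, PolyFam (h i)) : PolyFam (fun t x => ∑ i ∈ s, h i t x) := by
  choose p hp using hh
  refine ⟨∑ i ∈ s, p i, fun t x => ?_⟩
  simp [hp, Polynomial.eval_finsetSum]

theorem PolyFam.prod {n : ℕ} {ι : Type*} (s : Finset ι) {h : ι → ℝ → Vec n → ℝ}
    (hh : ∀ i, PolyFam (h i)) : PolyFam (fun t x => ∏ i ∈ s, h i t x) := by
  choose p hp using hh
  refine ⟨∏ i ∈ s, p i, fun t x => ?_⟩
  simp [hp, Polynomial.eval_prod]

theorem PolyFam.integral {n : ℕ} {h : ℝ → Vec n → ℝ} (hh : PolyFam h) {B : Set (Vec n)}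
    (hB : IsCompact B) : ∃ q : Polynomial ℝ, ∀ t, ∫ x in B, h t x = q.eval t := by
  obtain ⟨p, hp⟩ := hh
  refine ⟨∑ j ∈ Finset.range (p.natDegree + 1),
    Polynomial.C (∫ x in B, p.coeff j x) * Polynomial.X ^ j, fun t => ?_⟩
  have h1 : ∀ x, h t x = ∑ j ∈ Finset.range (p.natDegree + 1), p.coeff j x * t ^ j := by
    intro x
    rw [hp, Polynomial.eval_eq_sum_range]
    simp
  simp_rw [h1]
  rw [integral_finsetSum]
  · simp [Polynomial.eval_finsetSum, integral_mul_const]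
  · intro j _
    exact (((p.coeff j).continuous.mul continuous_const).continuousOn).integrableOn_compact hB

theorem PolyFam.det {n : ℕ} {w : Vec n → Vec n} (hw : ContDiff ℝ 1 w) :
    PolyFam (fun t x => (ContinuousLinearMap.id ℝ (Vec n) + t • fderiv ℝ w x).det) := by
  have hc : Continuous (fderiv ℝ w) := hw.continuous_fderiv (by norm_num)
  have : ∀ t x, (ContinuousLinearMap.id ℝ (Vec n) + t • fderiv ℝ w x).det
      = ∑ σ : Equiv.Perm (Fin n), ((Equiv.Perm.sign σ : ℤ) : ℝ) *
        ∏ i, ((Pi.single i (1 : ℝ) : Vec n) (σ i) + t * fderiv ℝ w x (Pi.single i 1) (σ i)) := by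
    intro t x
    rw [ContinuousLinearMap.det, ← LinearMap.det_toMatrix', Matrix.det_apply']
    simp [LinearMap.toMatrix'_apply]
  simp_rw [this]
  refine PolyFam.sum _ fun σ => (PolyFam.of_cont continuous_const).mul (PolyFam.prod _ fun i => ?_)
  refine (PolyFam.of_cont continuous_const).add (PolyFam.param.mul (PolyFam.of_cont ?_))
  exact (continuous_apply _).comp (hc.clm_apply continuous_const)

/-- sum of squares -/
def sqS {n : ℕ} (y : Vec n) : ℝ := ∑ i, y i ^ 2

theorem sqS_cont {n : ℕ} : Continuous (sqS : Vec n → ℝ) := by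
  unfold sqS; fun_prop

theorem small_diffeo {n : ℕ} {w : Vec n → Vec n} (hw : ContDiff ℝ 1 w)
    (hs : HasCompactSupport w) {B : Set (Vec n)} (hB : IsCompact B) (hwB : ∀ x, x ∉ B → w x = 0) :
    ∃ δ > 0, ∀ t : ℝ, 0 < t → t < δ → ∀ g : Vec n → ℝ,
      ∫ x in B, g (x + t • w x) * (ContinuousLinearMap.id ℝ (Vec n) + t • fderiv ℝ w x).det
        = ∫ x in B, g x := by
  obtain ⟨L, hL⟩ := hw.lipschitzWith_of_hasCompactSupport hs (by norm_num)
  have hdet : ∀ᶠ M : Vec n →L[ℝ] Vec n in 𝓝 (ContinuousLinearMap.id ℝ (Vec n)), 0 < M.det := by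
    refine ContinuousLinearMap.continuous_det.continuousAt.eventually (lt_mem_nhds ?_)
    simp [ContinuousLinearMap.det]
  obtain ⟨ε, hε, hdet⟩ := Metric.eventually_nhds_iff.1 hdet
  have hfd : ∀ x, ‖fderiv ℝ w x‖ ≤ L := fun x => norm_fderiv_le_of_lipschitz ℝ hL
  have hLp : (0 : ℝ) < L + 1 := by positivity
  refine ⟨min 1 ε / (L + 1), by positivity, fun t ht htδ g => ?_⟩
  have htL : t * (L + 1) < min 1 ε := (lt_div_iff₀ hLp).1 htδ
  have ht1 : t * L < 1 := by nlinarith [min_le_left 1 ε]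
  have ht2 : t * L < ε := by nlinarith [min_le_right 1 ε]
  have hpos : ∀ x, 0 < (ContinuousLinearMap.id ℝ (Vec n) + t • fderiv ℝ w x).det := by
    intro x
    apply hdet
    rw [dist_eq_norm, add_sub_cancel_left, norm_smul, Real.norm_of_nonneg ht.le]
    exact lt_of_le_of_lt (mul_le_mul_of_nonneg_left (hfd x) ht.le) ht2
  have hcon : ∀ y, ContractingWith (t.toNNReal * L) (fun x => y - t • w x) := by
    intro y
    refine ⟨by rw [← NNReal.coe_lt_coe, NNReal.coe_mul, Real.coe_toNNReal t ht.le]; exact ht1, ?_⟩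
    refine LipschitzWith.of_dist_le_mul fun a b => ?_
    have := hL.dist_le_mul a b
    rw [dist_eq_norm] at this ⊢
    rw [show y - t • w a - (y - t • w b) = -(t • (w a - w b)) by rw [smul_sub]; abel,
      norm_neg, norm_smul, Real.norm_of_nonneg ht.le]
    calc t * ‖w a - w b‖ ≤ t * (L * dist a b) := mul_le_mul_of_nonneg_left this ht.le
      _ = _ := by rw [NNReal.coe_mul, Real.coe_toNNReal t ht.le, mul_assoc]
  have hinj : Function.Injective (fun x => x + t • w x) := by
    intro a b hab
    simp only at hab
    refine (hcon (a + t • w a)).fixedPoint_unique' ?_ ?_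
    · simp [Function.IsFixedPt]
    · simp [Function.IsFixedPt, hab]
  have hsurj : Function.Surjective (fun x => x + t • w x) := by
    intro y
    have := (hcon y).fixedPoint_isFixedPt
    refine ⟨ContractingWith.fixedPoint _ (hcon y), ?_⟩
    simp only [Function.IsFixedPt] at this
    exact (eq_sub_iff_add_eq.1 this.symm)
  have himg : (fun x => x + t • w x) '' B = B := by
    ext y
    constructor
    · rintro ⟨x, hx, rfl⟩
      by_contra hn
      have h1 := hwB _ hn
      have : x = x + t • w x := hinj (by simp only; rw [h1]; simp)
      simp only at hn
      rw [← this] at hn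
      exact hn hx
    · intro hy
      obtain ⟨x, rfl⟩ := hsurj y
      by_cases hx : x ∈ B
      · exact ⟨x, hx, rfl⟩
      · simp only [hwB x hx, smul_zero, add_zero] at hy
        exact absurd hy hx
  have := integral_image_eq_integral_abs_det_fderiv_smul (volume : Measure (Vec n)) (s := B)
    (f := fun x => x + t • w x)
    (f' := fun x => ContinuousLinearMap.id ℝ (Vec n) + t • fderiv ℝ w x) hB.measurableSet
    (fun x _ => ((hasFDerivAt_id x).add
      (((hw.differentiable (by norm_num)) x).hasFDerivAt.const_smul t)).hasFDerivWithinAt)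
    hinj.injOn g
  rw [himg] at this
  rw [this]
  refine integral_congr_ae (Eventually.of_forall fun x => ?_)
  simp only [smul_eq_mul, abs_of_pos (hpos x)]
  ring

theorem lemmaA {n : ℕ} {w : Vec n → Vec n} (hw : ContDiff ℝ 1 w)
    (hs : HasCompactSupport w)
    (hdet : ∀ x, sqS (x + w x) < 1 → (ContinuousLinearMap.id ℝ (Vec n) + fderiv ℝ w x).det = 0) :
    False := by
  obtain ⟨R, hR⟩ := hs.isBounded.subset_closedBall 0
  set B : Set (Vec n) := Metric.closedBall 0 (max R 1) with hBdef
  have hB : IsCompact B := isCompact_closedBall _ _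
  have hwB : ∀ x, x ∉ B → w x = 0 := by
    intro x hx
    by_contra h
    exact hx (Metric.closedBall_subset_closedBall (le_max_left _ _)
      (hR (subset_tsupport _ h)))
  have hGc : Continuous (fun x => sqS (x + w x)) :=
    sqS_cont.comp (continuous_id.add hw.continuous)
  have hfc : Continuous (fderiv ℝ w) := hw.continuous_fderiv (by norm_num)
  have hdc : Continuous (fun x => (ContinuousLinearMap.id ℝ (Vec n) + fderiv ℝ w x).det) :=
    ContinuousLinearMap.continuous_det.comp (continuous_const.add hfc)
  obtain ⟨M1, hM1⟩ := (hB.image hGc).bddAbove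
  obtain ⟨M2, hM2⟩ := (hB.image sqS_cont).bddAbove
  set M := max (max M1 M2) 2
  have hM2' : 2 ≤ M := le_max_right _ _
  have hMG : ∀ x ∈ B, sqS (x + w x) ≤ M := fun x hx =>
    (hM1 ⟨x, hx, rfl⟩).trans ((le_max_left _ _).trans (le_max_left _ _))
  have hMB : ∀ x ∈ B, sqS x ≤ M := fun x hx =>
    (hM2 ⟨x, hx, rfl⟩).trans ((le_max_right _ _).trans (le_max_left _ _))
  obtain ⟨δ, hδ, hsm⟩ := small_diffeo hw hs hB hwB
  -- the polynomial identity
  have key : ∀ k : ℕ,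
      ∫ x in B, (M - sqS (x + w x)) ^ k *
        (ContinuousLinearMap.id ℝ (Vec n) + fderiv ℝ w x).det = ∫ x in B, (M - sqS x) ^ k := by
    intro k
    have hP : PolyFam (fun t x => (M + (-1) * ∑ i, (x i + t * w x i) ^ 2) ^ k *
        (ContinuousLinearMap.id ℝ (Vec n) + t • fderiv ℝ w x).det) := by
      refine PolyFam.mul (PolyFam.pow ((PolyFam.of_cont continuous_const).add
        ((PolyFam.of_cont continuous_const).mul (PolyFam.sum _ fun i => PolyFam.pow ?_ 2))) k)
        (PolyFam.det hw)
      exact (PolyFam.of_cont (continuous_apply i)).add (PolyFam.param.mul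
        (PolyFam.of_cont ((continuous_apply i).comp hw.continuous)))
    obtain ⟨q, hq⟩ := hP.integral hB
    have hq' : q = Polynomial.C (∫ x in B, (M - sqS x) ^ k) := by
      apply Polynomial.eq_of_infinite_eval_eq
      refine (Set.Ioo_infinite hδ).mono ?_
      intro t ht
      simp only [mem_ofPred_eq, Polynomial.eval_C]
      rw [← hq, ← hsm t ht.1 ht.2 (fun x => (M - sqS x) ^ k)]
      simp [sqS, sub_eq_add_neg]
    have h1 := hq 1
    rw [hq', Polynomial.eval_C] at h1
    rw [← h1]
    simp [sqS, sub_eq_add_neg]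
  set C := ∫ x in B, |(ContinuousLinearMap.id ℝ (Vec n) + fderiv ℝ w x).det| with hC
  have hup : ∀ k : ℕ, ∫ x in B, (M - sqS (x + w x)) ^ k *
        (ContinuousLinearMap.id ℝ (Vec n) + fderiv ℝ w x).det ≤ (M - 1) ^ k * C := by
    intro k
    rw [hC, ← integral_const_mul]
    refine setIntegral_mono_on ?_ ?_ hB.measurableSet ?_
    · exact ((((continuous_const.sub hGc).pow k).mul hdc).continuousOn).integrableOn_compact hB
    · exact ((continuous_const.mul hdc.abs).continuousOn).integrableOn_compact hB
    · intro x hx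
      by_cases h : sqS (x + w x) < 1
      · rw [hdet x h]; simp
      · push Not at h
        have h3 := hMG x hx
        calc _ ≤ (M - sqS (x + w x)) ^ k *
            |(ContinuousLinearMap.id ℝ (Vec n) + fderiv ℝ w x).det| :=
              mul_le_mul_of_nonneg_left (le_abs_self _) (pow_nonneg (by linarith) _)
          _ ≤ _ := mul_le_mul_of_nonneg_right
              (pow_le_pow_left₀ (by linarith) (by linarith) _) (abs_nonneg _)
  set U : Set (Vec n) := {x | sqS x < 1 / 4} with hU
  have hUo : IsOpen U := isOpen_lt sqS_cont continuous_const
  have hU0 : (0 : Vec n) ∈ U := by simp [hU, sqS]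
  have hUB : U ⊆ B := by
    intro x hx
    rw [hBdef, mem_closedBall_zero_iff]
    refine le_trans ?_ (le_max_right _ _)
    refine (pi_norm_le_iff_of_nonneg zero_le_one).2 fun i => ?_
    have : x i ^ 2 ≤ sqS x := Finset.single_le_sum (f := fun i => x i ^ 2)
      (fun i _ => sq_nonneg _) (Finset.mem_univ i)
    have hx' : sqS x < 1 / 4 := hx
    rw [Real.norm_eq_abs]
    exact abs_le_one_iff_mul_self_le_one.2 (by nlinarith)
  have hUfin : volume U ≠ ⊤ := ne_top_of_le_ne_top hB.measure_lt_top.ne (measure_mono hUB)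
  have hc : 0 < volume.real U :=
    ENNReal.toReal_pos (hUo.measure_pos _ ⟨0, hU0⟩).ne' hUfin
  have hlow : ∀ k : ℕ, (M - 1 / 4) ^ k * volume.real U ≤ ∫ x in B, (M - sqS x) ^ k := by
    intro k
    have hi : IntegrableOn (fun x => (M - sqS x) ^ k) B :=
      (((continuous_const.sub sqS_cont).pow k).continuousOn).integrableOn_compact hB
    calc (M - 1 / 4) ^ k * volume.real U = ∫ x in U, (M - 1 / 4) ^ k := by
          simp [mul_comm]
      _ ≤ ∫ x in U, (M - sqS x) ^ k := by
          refine setIntegral_mono_on (integrableOn_const hUfin) (hi.mono_set hUB)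
            hUo.measurableSet fun x hx => ?_
          have hx' : sqS x < 1 / 4 := hx
          exact pow_le_pow_left₀ (by linarith) (by linarith) _
      _ ≤ ∫ x in B, (M - sqS x) ^ k := by
          refine setIntegral_mono_set hi ?_ hUB.eventuallyLE
          refine (ae_restrict_iff' hB.measurableSet).2 (Eventually.of_forall fun x hx => ?_)
          exact pow_nonneg (sub_nonneg.2 (hMB x hx)) _
  have hfin : ∀ k : ℕ, ((M - 1 / 4) / (M - 1)) ^ k ≤ C / volume.real U := by
    intro k
    have := ((hlow k).trans (key k).symm.le).trans (hup k)
    have hp : 0 < (M - 1) ^ k := pow_pos (by linarith) _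
    rw [div_pow, div_le_div_iff₀ hp hc]
    linarith
  obtain ⟨k, hk⟩ := pow_unbounded_of_one_lt (C / volume.real U)
    (show 1 < (M - 1 / 4) / (M - 1) by rw [lt_div_iff₀ (by linarith)]; linarith)
  exact absurd hk (not_lt.2 (hfin k))

theorem lemmaB {n : ℕ} {F : Vec n → Vec n} (hF : ContDiff ℝ 1 F)
    (hdet : ∀ x, (fderiv ℝ F x).det = 0)
    (hb : Bornology.IsBounded {x : Vec n | ∃ y ∈ segment ℝ x (F x), ‖y‖ ≤ 1}) : False := by
  obtain ⟨R, hR⟩ := hb.subset_closedBall 0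
  let χ : ContDiffBump (0 : Vec n) :=
    ⟨max R 0 + 1, max R 0 + 2, by positivity, by linarith⟩
  have hv : ContDiff ℝ 1 (fun x => F x - x) := hF.sub contDiff_id
  have hw : ContDiff ℝ 1 (fun x => χ x • (F x - x)) := χ.contDiff.smul hv
  refine lemmaA hw (χ.hasCompactSupport.smul_right) fun x hx => ?_
  have hmem : x ∈ Metric.closedBall (0 : Vec n) R := by
    apply hR
    refine ⟨x + χ x • (F x - x), ?_, ?_⟩
    · rw [segment_eq_image']
      exact ⟨χ x, ⟨χ.nonneg, χ.le_one⟩, rfl⟩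
    · refine (pi_norm_le_iff_of_nonneg zero_le_one).2 fun i => ?_
      have := Finset.single_le_sum (f := fun i => (x + χ x • (F x - x)) i ^ 2)
        (fun i _ => sq_nonneg _) (Finset.mem_univ i)
      rw [Real.norm_eq_abs]
      refine abs_le_one_iff_mul_self_le_one.2 ?_
      unfold sqS at hx
      nlinarith
  have hev : (fun x => χ x • (F x - x)) =ᶠ[𝓝 x] fun x => F x - x := by
    have : x ∈ Metric.ball (0 : Vec n) χ.rIn := by
      rw [mem_closedBall_zero_iff] at hmem
      rw [mem_ball_zero_iff]
      have : χ.rIn = max R 0 + 1 := rfl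
      linarith [le_max_left R 0]
    filter_upwards [χ.eventuallyEq_one_of_mem_ball this] with z hz
    rw [hz]; simp
  rw [hev.fderiv_eq, fderiv_fun_sub ((hF.differentiable (by norm_num)) x) differentiableAt_fun_id]
  simpa using hdet x

theorem contDiffAt_finsum' {ι E F : Type*} [NormedAddCommGroup E] [NormedSpace ℝ E]
    [NormedAddCommGroup F] [NormedSpace ℝ F] {h : ι → E → F} {y : E}
    (hd : ∀ i, ContDiffAt ℝ 1 (h i) y) {N : Set E} (hN : N ∈ 𝓝 y)
    (hfin : {i | ∃ y' ∈ N, h i y' ≠ 0}.Finite) :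
    ContDiffAt ℝ 1 (fun y => ∑ᶠ i, h i y) y := by
  have : (fun y => ∑ᶠ i, h i y) =ᶠ[𝓝 y] fun y => ∑ i ∈ hfin.toFinset, h i y := by
    filter_upwards [hN] with z hz
    refine finsum_eq_sum_of_support_subset _ fun i hi => ?_
    simpa using ⟨z, hz, hi⟩
  exact (ContDiffAt.sum fun i _ => hd i).congr_of_eventuallyEq this

theorem det_zero_of_homog {n : ℕ} {g : Vec n → Vec n} {y : Vec n} (hy : y ≠ 0)
    (hg : DifferentiableAt ℝ g y) (hh : ∀ c : ℝ, 0 < c → g (c • y) = g y) :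
    (fderiv ℝ g y).det = 0 := by
  have h1 : HasDerivAt (fun c : ℝ => g (c • y)) (fderiv ℝ g y y) 1 := by
    have h2 : HasDerivAt (fun c : ℝ => c • y) y 1 := by
      simpa using (hasDerivAt_id (1 : ℝ)).smul_const y
    have h3 : HasFDerivAt g (fderiv ℝ g y) ((1 : ℝ) • y) := by
      simpa using hg.hasFDerivAt
    exact h3.comp_hasDerivAt (1 : ℝ) h2
  have h2 : HasDerivAt (fun c : ℝ => g (c • y)) 0 1 := by
    refine (hasDerivAt_const (1 : ℝ) (g y)).congr_of_eventuallyEq ?_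
    filter_upwards [lt_mem_nhds (zero_lt_one' ℝ)] with c hc
    exact hh c hc
  have h0 := h1.unique h2
  by_contra hne
  have := (LinearMap.equivOfDetNeZero (fderiv ℝ g y : Vec n →ₗ[ℝ] Vec n) hne).injective
    (a₁ := y) (a₂ := 0) (by simpa [LinearMap.equivOfDetNeZero] using h0)
  exact hy this

/-- linear part of an element of the group -/
def linP {n : ℕ} {Γ : Subgroup (AffGroup n)} (γ : Γ) : Vec n ≃ₗ[ℝ] Vec n :=
  AffineEquiv.linearHom (γ : AffGroup n)

theorem linP_mul {n : ℕ} {Γ : Subgroup (AffGroup n)} (γ δ : Γ) (y : Vec n) :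
    linP (γ * δ) y = linP γ (linP δ y) := rfl

theorem linP_one {n : ℕ} {Γ : Subgroup (AffGroup n)} (y : Vec n) :
    linP (1 : Γ) y = y := rfl

theorem act_eq {n : ℕ} {Γ : Subgroup (AffGroup n)} (γ : Γ) (y : Vec n) :
    (γ : AffGroup n) y = linP γ y + (γ : AffGroup n) 0 := by
  have := (γ : AffGroup n).map_vadd 0 y
  simpa [linP] using this

theorem linP_cont {n : ℕ} {Γ : Subgroup (AffGroup n)} (γ : Γ) : ContDiff ℝ 1 (linP γ) :=
  (LinearMap.toContinuousLinearMap (linP γ : Vec n →ₗ[ℝ] Vec n)).contDiff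

theorem act_cont {n : ℕ} {Γ : Subgroup (AffGroup n)} (γ : Γ) :
    ContDiff ℝ 1 (γ : AffGroup n) := by
  have : ((γ : AffGroup n) : Vec n → Vec n) = fun y => linP γ y + (γ : AffGroup n) 0 := by
    ext1 y; exact act_eq γ y
  rw [this]
  exact (linP_cont γ).add contDiff_const

theorem lemmaC {n : ℕ} (Γ : Subgroup (AffGroup n)) (C : Set (Vec n)) (ℓ : Vec n →L[ℝ] ℝ)
    (hCo : IsOpen C) (hadd : ∀ x ∈ C, ∀ y ∈ C, x + y ∈ C)
    (hsmul : ∀ c : ℝ, 0 < c → ∀ x ∈ C, c • x ∈ C) (e : Vec n) (he : e ∈ C)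
    (hℓ : ∀ x ∈ C, 0 < ℓ x) (hpres : ∀ γ : Γ, ∀ x ∈ C, linP γ x ∈ C)
    (hPDC : ∀ S ⊆ C, IsCompact S →
      {γ : Γ | ∃ y ∈ S, ∃ c : ℝ, 0 < c ∧ c • linP γ y ∈ S}.Finite)
    (hPD : ProperlyDisc Γ) (hCC : CocompactAction Γ) : False := by
  have hPD' : ∀ S : Set (Vec n), IsCompact S →
      {γ : Γ | ∃ y ∈ S, (γ : AffGroup n) y ∈ S}.Finite := by
    intro S hS
    refine ((hPD S hS).preimage (Subtype.val_injective.injOn)).subset ?_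
    rintro γ ⟨y, hy, hy'⟩
    exact ⟨γ.2, _, ⟨y, hy, rfl⟩, hy'⟩
  obtain ⟨K, hK, hKcov⟩ := hCC
  have hcov : ∀ x, ∃ γ : Γ, ∃ k ∈ K, x = (γ : AffGroup n) k := by
    intro x
    obtain ⟨γ, hγ, hx⟩ := hKcov x
    refine ⟨⟨γ, hγ⟩⁻¹, γ x, hx, ?_⟩
    simp [AffineEquiv.inv_def]
  obtain ⟨R, hR⟩ := hK.isBounded.subset_ball 0
  obtain ⟨ψ, hψs, hψc, hψr⟩ :=
    (Metric.isOpen_ball (x := (0 : Vec n)) (ε := R)).exists_contDiff_support_eq (n := 1)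
  have hψ0 : ∀ x, 0 ≤ ψ x := fun x => (hψr ⟨x, rfl⟩).1
  have inv_app : ∀ (δ : Γ) (x : Vec n), (δ : AffGroup n) (((δ⁻¹ : Γ) : AffGroup n) x) = x := by
    intro δ x; simp [AffineEquiv.inv_def]
  have invL : ∀ (δ : Γ) (x : Vec n), linP δ (linP δ⁻¹ x) = x := by
    intro δ x; rw [← linP_mul]; simp [linP_one]
  -- the map f
  set f : Vec n → Vec n := fun x => ∑ᶠ δ : Γ, ψ (((δ⁻¹ : Γ) : AffGroup n) x) • linP δ e with hf
  have hlocf : ∀ x, {δ : Γ | ∃ x' ∈ Metric.closedBall x 1,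
      ψ (((δ⁻¹ : Γ) : AffGroup n) x') ≠ 0}.Finite := by
    intro x
    refine (hPD' (Metric.closedBall 0 R ∪ Metric.closedBall x 1)
      ((isCompact_closedBall _ _).union (isCompact_closedBall _ _))).subset ?_
    rintro δ ⟨x', hx', hne⟩
    refine ⟨((δ⁻¹ : Γ) : AffGroup n) x', Or.inl ?_, Or.inr ?_⟩
    · apply Metric.ball_subset_closedBall
      rw [← hψs]; exact hne
    · rw [inv_app]; exact hx'
  have hfc : ContDiff ℝ 1 f := by
    rw [contDiff_iff_contDiffAt]
    intro x
    refine contDiffAt_finsum' (fun δ => ?_) (Metric.closedBall_mem_nhds x one_pos)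
      ((hlocf x).subset ?_)
    · exact ((hψc.comp (act_cont δ⁻¹)).smul contDiff_const).contDiffAt
    · rintro δ ⟨x', hx', hne⟩
      exact ⟨x', hx', fun h => hne (by rw [h, zero_smul])⟩
  have hfC : ∀ x, f x ∈ C := by
    intro x
    have hfin : {δ : Γ | ψ (((δ⁻¹ : Γ) : AffGroup n) x) ≠ 0}.Finite :=
      (hlocf x).subset fun δ hδ => ⟨x, Metric.mem_closedBall_self zero_le_one, hδ⟩
    have : f x = ∑ δ ∈ hfin.toFinset, ψ (((δ⁻¹ : Γ) : AffGroup n) x) • linP δ e := by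
      refine finsum_eq_sum_of_support_subset _ fun δ hδ => ?_
      simp only [Finite.coe_toFinset]
      intro h
      exact hδ (by simp only [h, zero_smul])
    rw [this]
    refine Finset.sum_induction_nonempty _ (· ∈ C) (fun a b ha hb => hadd a ha b hb) ?_ ?_
    · obtain ⟨γ, k, hk, rfl⟩ := hcov x
      refine ⟨γ, ?_⟩
      simp only [Finite.mem_toFinset]
      have : ψ k ≠ 0 := by
        have := hR hk
        rw [← hψs] at this; exact this
      simpa [AffineEquiv.inv_def] using this
    · intro δ hδ
      simp only [Finite.mem_toFinset] at hδ
      exact hsmul _ (lt_of_le_of_ne (hψ0 _) (Ne.symm hδ)) _ (hpres δ e he)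
  have hfeq : ∀ (γ : Γ) x, f ((γ : AffGroup n) x) = linP γ (f x) := by
    intro γ x
    simp only [hf]
    rw [← finsum_comp_equiv (Equiv.mulLeft γ)]
    have := (linP γ).toAddEquiv.map_finsum
      (fun δ : Γ => ψ (((δ⁻¹ : Γ) : AffGroup n) x) • linP δ e)
    simp only [LinearEquiv.coe_toAddEquiv] at this
    rw [show (linP γ) (∑ᶠ δ : Γ, ψ (((δ⁻¹ : Γ) : AffGroup n) x) • linP δ e) = _ from this]
    refine finsum_congr fun δ => ?_
    have h1 : (((γ * δ)⁻¹ : Γ) : AffGroup n) ((γ : AffGroup n) x)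
        = ((δ⁻¹ : Γ) : AffGroup n) x := by
      simp [AffineEquiv.inv_def, AffineEquiv.mul_def]
    rw [Equiv.coe_mulLeft, h1, linP_mul]
    simp
  -- the homogeneous bump
  have hℓc : ∀ x, 0 < ℓ (f x) := fun x => hℓ _ (hfC x)
  set S0 : Set (Vec n) := (fun x => (ℓ (f x))⁻¹ • f x) '' K with hS0
  have hS0c : IsCompact S0 := by
    refine hK.image ?_
    exact ((ℓ.continuous.comp hfc.continuous).inv₀ fun x => (hℓc x).ne').smul hfc.continuous
  have hS0C : S0 ⊆ C := by
    rintro _ ⟨x, -, rfl⟩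
    exact hsmul _ (inv_pos.2 (hℓc x)) _ (hfC x)
  obtain ⟨K', hK'c, hK'1, hK'2⟩ := exists_compact_between hS0c hCo hS0C
  obtain ⟨φ0, hφs, hφc, hφr⟩ :=
    (isOpen_interior (s := K')).exists_contDiff_support_eq (n := 1)
  have hφ00 : ∀ x, 0 ≤ φ0 x := fun x => (hφr ⟨x, rfl⟩).1
  set φ : Vec n → ℝ := fun y => φ0 ((ℓ y)⁻¹ • y) with hφ
  have hφhom : ∀ (c : ℝ) y, 0 < c → φ (c • y) = φ y := by
    intro c y hc
    simp only [hφ, map_smul, smul_eq_mul, mul_inv, smul_smul]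
    congr 2
    field_simp
  have hφC : ∀ y ∈ C, ContDiffAt ℝ 1 φ y := by
    intro y hy
    refine hφc.contDiffAt.comp y ?_
    exact (ℓ.contDiff.contDiffAt.inv (hℓ y hy).ne').smul contDiffAt_id
  have hlocg : ∀ y ∈ C, ∃ N ∈ 𝓝 y, {δ : Γ | ∃ y' ∈ N, φ (linP δ⁻¹ y') ≠ 0}.Finite := by
    intro y hy
    obtain ⟨N, hNc, hN1, hN2⟩ := exists_compact_between (isCompact_singleton (x := y)) hCo
      (singleton_subset_iff.2 hy)
    refine ⟨N, mem_interior_iff_mem_nhds.1 (hN1 rfl), ?_⟩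
    refine ((hPDC (N ∪ K') (union_subset hN2 hK'2) (hNc.union hK'c)).preimage
      (inv_injective.injOn)).subset ?_
    rintro δ ⟨y', hy', hne⟩
    refine ⟨y', Or.inl hy', (ℓ (linP δ⁻¹ y'))⁻¹,
      inv_pos.2 (hℓ _ (hpres _ _ (hN2 hy'))), Or.inr ?_⟩
    apply interior_subset
    rw [← hφs]; exact hne
  set s : Vec n → ℝ := fun y => ∑ᶠ δ : Γ, φ (linP δ⁻¹ y) with hs
  set T : Vec n → Vec n := fun y => ∑ᶠ δ : Γ, φ (linP δ⁻¹ y) • (δ : AffGroup n) 0 with hT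
  have hφL : ∀ y ∈ C, ∀ δ : Γ, ContDiffAt ℝ 1 (fun y => φ (linP δ⁻¹ y)) y := fun y hy δ =>
    (hφC _ (hpres δ⁻¹ y hy)).comp y (linP_cont δ⁻¹).contDiffAt
  have hsC : ∀ y ∈ C, ContDiffAt ℝ 1 s y := by
    intro y hy
    obtain ⟨N, hN, hfin⟩ := hlocg y hy
    exact contDiffAt_finsum' (hφL y hy) hN hfin
  have hTC : ∀ y ∈ C, ContDiffAt ℝ 1 T y := by
    intro y hy
    obtain ⟨N, hN, hfin⟩ := hlocg y hy
    refine contDiffAt_finsum' (fun δ => (hφL y hy δ).smul contDiffAt_const) hN (hfin.subset ?_)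
    rintro δ ⟨x', hx', hne⟩
    exact ⟨x', hx', fun h => hne (by rw [h, zero_smul])⟩
  have hfinS : ∀ y ∈ C, (Function.support fun δ : Γ => φ (linP δ⁻¹ y)).Finite := by
    intro y hy
    obtain ⟨N, hN, hfin⟩ := hlocg y hy
    exact hfin.subset fun δ hδ => ⟨y, mem_of_mem_nhds hN, hδ⟩
  have hcancel : ∀ (γ δ : Γ) y, linP (γ * δ)⁻¹ (linP γ y) = linP δ⁻¹ y := by
    intro γ δ y
    rw [← linP_mul]; congr 1; simp
  have hsinv : ∀ (γ : Γ) y, s (linP γ y) = s y := by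
    intro γ y
    simp only [hs]
    rw [← finsum_comp_equiv (Equiv.mulLeft γ)]
    refine finsum_congr fun δ => ?_
    rw [Equiv.coe_mulLeft, hcancel]
  have hTinv : ∀ (γ : Γ), ∀ y ∈ C, T (linP γ y) = linP γ (T y) + s y • (γ : AffGroup n) 0 := by
    intro γ y hy
    simp only [hs, hT]
    rw [← finsum_comp_equiv (Equiv.mulLeft γ)]
    have := (linP γ).toAddEquiv.map_finsum
      (fun δ : Γ => φ (linP δ⁻¹ y) • (δ : AffGroup n) 0)
    simp only [LinearEquiv.coe_toAddEquiv] at this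
    rw [show (linP γ) (∑ᶠ δ : Γ, φ (linP δ⁻¹ y) • (δ : AffGroup n) 0) = _ from this,
      finsum_smul' (hfinS y hy), ← finsum_add_distrib]
    · refine finsum_congr fun δ => ?_
      rw [Equiv.coe_mulLeft, hcancel, Subgroup.coe_mul, AffineEquiv.coe_mul,
        Function.comp_apply, act_eq γ, smul_add]
      simp
    · refine (hfinS y hy).subset fun δ hδ h => hδ ?_
      simp [show φ (linP δ⁻¹ y) = 0 from h]
    · refine (hfinS y hy).subset fun δ hδ h => hδ ?_
      simp [show φ (linP δ⁻¹ y) = 0 from h]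
  have hspos : ∀ x, 0 < s (f x) := by
    intro x
    obtain ⟨γ, k, hk, rfl⟩ := hcov x
    rw [hfeq, hsinv]
    refine lt_of_lt_of_le ?_ (single_le_finsum (1 : Γ) (hfinS _ (hfC k)) fun δ => hφ00 _)
    have : (ℓ (f k))⁻¹ • f k ∈ Function.support φ0 := by
      rw [hφs]; exact hK'1 ⟨k, hk, rfl⟩
    refine lt_of_le_of_ne (hφ00 _) (Ne.symm ?_)
    simpa [hφ, linP_one] using this
  set g : Vec n → Vec n := fun y => (s y)⁻¹ • T y with hg
  have hgC : ∀ x, ContDiffAt ℝ 1 g (f x) := fun x =>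
    ((hsC _ (hfC x)).inv (hspos x).ne').smul (hTC _ (hfC x))
  have hghom : ∀ (c : ℝ) y, 0 < c → g (c • y) = g y := by
    intro c y hc
    simp only [hg, hs, hT, map_smul, hφhom c _ hc]
  have hFc : ContDiff ℝ 1 (g ∘ f) := by
    rw [contDiff_iff_contDiffAt]
    exact fun x => (hgC x).comp x hfc.contDiffAt
  have hFeq : ∀ (γ : Γ) x, (g ∘ f) ((γ : AffGroup n) x) = (γ : AffGroup n) ((g ∘ f) x) := by
    intro γ x
    simp only [Function.comp, hg]
    rw [hfeq, hsinv, hTinv γ _ (hfC x), act_eq γ ((s (f x))⁻¹ • T (f x)), smul_add, map_smul, smul_smul,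
      inv_mul_cancel₀ (hspos x).ne', one_smul]
  refine lemmaB hFc (fun x => ?_) ?_
  · rw [fderiv_comp x ((hgC x).differentiableAt (by norm_num))
      (hfc.differentiable (by norm_num) x)]
    have h0 := det_zero_of_homog (y := f x) (fun h => by have := hℓc x; rw [h] at this; simp at this)
      ((hgC x).differentiableAt (by norm_num)) (fun c hc => hghom c _ hc)
    simp only [ContinuousLinearMap.det, ContinuousLinearMap.toLinearMap_comp] at h0 ⊢
    rw [LinearMap.det_comp, h0, zero_mul]
  · obtain ⟨R', hR'⟩ := (hK.union (hK.image hFc.continuous)).isBounded.subset_closedBall 0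
    have hfin := hPD' (Metric.closedBall 0 R' ∪ Metric.closedBall 0 1)
      ((isCompact_closedBall _ _).union (isCompact_closedBall _ _))
    have hbdd : IsCompact (⋃ γ ∈ {γ : Γ | ∃ y ∈ Metric.closedBall (0 : Vec n) R' ∪ Metric.closedBall 0 1,
        (γ : AffGroup n) y ∈ Metric.closedBall (0 : Vec n) R' ∪ Metric.closedBall 0 1},
        (γ : AffGroup n) '' K) :=
      hfin.isCompact_biUnion fun γ _ => hK.image (act_cont γ).continuous
    refine hbdd.isBounded.subset ?_
    rintro x ⟨y, hy, hy1⟩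
    obtain ⟨γ, k, hk, rfl⟩ := hcov x
    rw [hFeq] at hy
    have h1 : (γ : AffGroup n) '' segment ℝ k ((g ∘ f) k)
        = segment ℝ ((γ : AffGroup n) k) ((γ : AffGroup n) ((g ∘ f) k)) :=
      image_segment ℝ ((γ : AffGroup n) : Vec n →ᵃ[ℝ] Vec n) _ _
    rw [← h1] at hy
    obtain ⟨z, hz, rfl⟩ := hy
    refine mem_biUnion (x := γ) ⟨z, Or.inl ?_, Or.inr ?_⟩ ⟨k, hk, rfl⟩
    · exact (convex_closedBall _ _).segment_subset (hR' (Or.inl hk))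
        (hR' (Or.inr ⟨k, hk, rfl⟩)) hz
    · simpa using hy1


/-- the open future cone -/
def fCone (m : ℕ) : Set (Vec (m + 2)) := {x | lorentzQ m x < 0 ∧ 0 < x (Fin.last (m + 1))}

/-- the spatial part as a euclidean vector -/
def spPart {m : ℕ} (x : Vec (m + 2)) : EuclideanSpace ℝ (Fin (m + 1)) :=
  WithLp.toLp 2 fun i => x i.castSucc

theorem lorentzQ_eq {m : ℕ} (x : Vec (m + 2)) :
    lorentzQ m x = ‖spPart x‖ ^ 2 - x (Fin.last (m + 1)) ^ 2 := by
  rw [EuclideanSpace.norm_sq_eq]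
  simp [lorentzQ, spPart]

theorem mem_fCone {m : ℕ} (x : Vec (m + 2)) :
    x ∈ fCone m ↔ ‖spPart x‖ < x (Fin.last (m + 1)) := by
  have h0 := norm_nonneg (spPart x)
  unfold fCone
  rw [mem_ofPred_eq, lorentzQ_eq]
  constructor
  · rintro ⟨h1, h2⟩
    exact lt_of_pow_lt_pow_left₀ 2 h2.le (by linarith)
  · intro h
    exact ⟨by nlinarith, by linarith⟩

theorem lorentzQ_smul {m : ℕ} (c : ℝ) (x : Vec (m + 2)) :
    lorentzQ m (c • x) = c ^ 2 * lorentzQ m x := by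
  simp only [lorentzQ, Pi.smul_apply, smul_eq_mul, mul_pow, ← Finset.mul_sum]
  ring

theorem lorentzQ_neg {m : ℕ} (x : Vec (m + 2)) :
    lorentzQ m (-x) = lorentzQ m x := by
  simp [lorentzQ]

theorem lorentzQ_cont (m : ℕ) : Continuous (lorentzQ m) := by
  unfold lorentzQ; fun_prop

theorem fCone_add {m : ℕ} (x : Vec (m + 2)) (hx : x ∈ fCone m) (y : Vec (m + 2))
    (hy : y ∈ fCone m) : x + y ∈ fCone m := by
  rw [mem_fCone] at *
  have : spPart (x + y) = spPart x + spPart y := rfl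
  rw [this]
  have := norm_add_le (spPart x) (spPart y)
  simp only [Pi.add_apply]
  linarith

theorem fCone_smul {m : ℕ} (c : ℝ) (hc : 0 < c) (x : Vec (m + 2)) (hx : x ∈ fCone m) :
    c • x ∈ fCone m := by
  refine ⟨?_, ?_⟩
  · rw [lorentzQ_smul]
    exact mul_neg_of_pos_of_neg (by positivity) hx.1
  · exact mul_pos hc hx.2

theorem fCone_open (m : ℕ) : IsOpen (fCone m) :=
  (isOpen_lt (lorentzQ_cont m) continuous_const).inter
    (isOpen_lt continuous_const (continuous_apply _))

theorem fCone_coord {m : ℕ} {x : Vec (m + 2)} (hx : x ∈ fCone m) (i : Fin (m + 1)) :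
    |x i.castSucc| < x (Fin.last (m + 1)) := by
  refine abs_lt_of_sq_lt_sq ?_ hx.2.le
  have h1 := Finset.single_le_sum (f := fun i : Fin (m + 1) => x i.castSucc ^ 2)
    (fun i _ => sq_nonneg _) (Finset.mem_univ i)
  have h2 : (∑ i : Fin (m + 1), x i.castSucc ^ 2) - x (Fin.last (m + 1)) ^ 2 < 0 := hx.1
  linarith

theorem fCone_interval {m : ℕ} {z w : Vec (m + 2)} (h1 : z + w ∈ fCone m) (h2 : z - w ∈ fCone m)
    (i : Fin (m + 2)) : |w i| ≤ z (Fin.last (m + 1)) := by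
  induction i using Fin.lastCases with
  | last =>
    have a := h1.2
    have b := h2.2
    simp only [Pi.add_apply, Pi.sub_apply] at a b
    rw [abs_le]; constructor <;> linarith
  | cast i =>
    have a := abs_lt.1 (fCone_coord h1 i)
    have b := abs_lt.1 (fCone_coord h2 i)
    simp only [Pi.add_apply, Pi.sub_apply] at a b
    rw [abs_le]; constructor <;> linarith [a.1, a.2, b.1, b.2]

theorem eCone (m : ℕ) : (Pi.single (Fin.last (m + 1)) 1 : Vec (m + 2)) ∈ fCone m := by
  refine ⟨?_, by simp⟩
  simp [lorentzQ, Fin.castSucc_ne_last]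

theorem bd_cone {m : ℕ} {S : Set (Vec (m + 2))} (hS : IsCompact S) (hSC : S ⊆ fCone m) :
    ∃ D : ℝ, ∀ N : Vec (m + 2) →ₗ[ℝ] Vec (m + 2), (∀ x ∈ fCone m, N x ∈ fCone m) →
      ∀ y ∈ S, N y ∈ S → ∀ i j, |N (Pi.single j 1) i| ≤ D := by
  obtain ⟨δ, hδ, hth⟩ := hS.exists_thickening_subset_open (fCone_open m) hSC
  obtain ⟨Z, hZ⟩ := (hS.image (continuous_apply (Fin.last (m + 1)))).bddAbove
  refine ⟨Z * (2 / δ), fun N hN y hy hNy i j => ?_⟩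
  set v : Vec (m + 2) := (δ / 2) • Pi.single j 1 with hv
  have hvn : ‖v‖ < δ := by
    rw [hv, norm_smul, Real.norm_of_nonneg (by positivity), Pi.norm_single]
    simp; linarith
  have h1 : y + v ∈ fCone m := hth (Metric.mem_thickening_iff.2 ⟨y, hy, by simpa using hvn⟩)
  have h2 : y - v ∈ fCone m := hth (Metric.mem_thickening_iff.2 ⟨y, hy, by
    simpa [dist_eq_norm] using hvn⟩)
  have h3 := hN _ h1
  have h4 := hN _ h2
  rw [map_add] at h3
  rw [map_sub] at h4
  have h5 := (fCone_interval h3 h4 i).trans (hZ ⟨_, hNy, rfl⟩)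
  rw [hv, map_smul, Pi.smul_apply, smul_eq_mul, abs_mul, abs_of_pos (by positivity)] at h5
  calc |N (Pi.single j 1) i| = (δ / 2 * |N (Pi.single j 1) i|) * (2 / δ) := by field_simp
    _ ≤ _ := mul_le_mul_of_nonneg_right h5 (by positivity)

theorem cone_dichotomy {m : ℕ} (N : Vec (m + 2) →ₗ[ℝ] Vec (m + 2)) (μ : ℝ) (hμ : 0 < μ)
    (hN : ∀ v, lorentzQ m (N v) = μ ^ 2 * lorentzQ m v) :
    (∀ x ∈ fCone m, N x ∈ fCone m) ∨ (∀ x ∈ fCone m, -N x ∈ fCone m) := by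
  have hne : ∀ x ∈ fCone m, lorentzQ m (N x) < 0 := fun x hx => by
    rw [hN]; exact mul_neg_of_pos_of_neg (by positivity) hx.1
  have hl : ∀ x ∈ fCone m, N x (Fin.last (m + 1)) ≠ 0 := by
    intro x hx h
    have := hne x hx
    rw [lorentzQ_eq, h] at this
    nlinarith [sq_nonneg ‖spPart (N x)‖]
  have hsame : ∀ x ∈ fCone m, ∀ y ∈ fCone m,
      0 < N x (Fin.last (m + 1)) → ¬ N y (Fin.last (m + 1)) < 0 := by
    intro x hx y hy h1 h2
    refine hl _ (fCone_add _ (fCone_smul (N x (Fin.last (m + 1))) h1 y hy) _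
      (fCone_smul (-N y (Fin.last (m + 1))) (by linarith) x hx)) ?_
    simp; ring
  rcases lt_or_gt_of_ne (hl _ (eCone m)) with h | h
  · right
    intro x hx
    refine ⟨by rw [lorentzQ_neg]; exact hne x hx, ?_⟩
    rcases lt_or_gt_of_ne (hl _ hx) with h' | h'
    · simpa using h'
    · exact absurd h (hsame _ hx _ (eCone m) h')
  · left
    intro x hx
    refine ⟨hne x hx, ?_⟩
    rcases lt_or_gt_of_ne (hl _ hx) with h' | h'
    · exact absurd h' (hsame _ (eCone m) _ hx h)
    · exact h'

theorem sim_scale {m : ℕ} {g : AffGroup (m + 2)} (h : InSimL m g) :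
    ∃ μ : ℝ, 0 < μ ∧ ∀ v, lorentzQ m (g.linear v) = μ ^ 2 * lorentzQ m v := by
  obtain ⟨lam, A, hl, hA, hg⟩ := h
  exact ⟨lam, hl, fun v => by rw [hg, lorentzQ_smul, hA]⟩

theorem lin_mul {n : ℕ} (g h : AffGroup n) (v : Vec n) :
    (g * h).linear v = g.linear (h.linear v) := rfl

theorem lin_inv {n : ℕ} (g : AffGroup n) (v : Vec n) :
    g.linear ((g⁻¹).linear v) = v := g.linear.apply_symm_apply v

theorem lin_inv' {n : ℕ} (g : AffGroup n) (v : Vec n) :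
    (g⁻¹).linear (g.linear v) = v := g.linear.symm_apply_apply v

/-- time orientation preserving subgroup -/
def gam0 (m : ℕ) (Γ : Subgroup (AffGroup (m + 2))) (hSim : ∀ γ ∈ Γ, InSimL m γ) :
    Subgroup (AffGroup (m + 2)) where
  carrier := {γ | γ ∈ Γ ∧ ∀ x ∈ fCone m, γ.linear x ∈ fCone m}
  mul_mem' := by
    rintro a b ⟨ha, ha'⟩ ⟨hb, hb'⟩
    exact ⟨Γ.mul_mem ha hb, fun x hx => ha' _ (hb' _ hx)⟩
  one_mem' := ⟨Γ.one_mem, fun x hx => hx⟩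
  inv_mem' := by
    rintro a ⟨ha, ha'⟩
    refine ⟨Γ.inv_mem ha, ?_⟩
    obtain ⟨μ, hμ, hQ⟩ := sim_scale (hSim _ (Γ.inv_mem ha))
    rcases cone_dichotomy ((a⁻¹).linear : Vec (m + 2) →ₗ[ℝ] Vec (m + 2)) μ hμ hQ with h | h
    · exact h
    · exfalso
      have h1 := ha' _ (h _ (eCone m))
      rw [map_neg] at h1
      have h2 := lin_inv a (Pi.single (Fin.last (m + 1)) 1)
      have h3 := h1.2
      rw [show a.linear ((a⁻¹.linear : Vec (m + 2) →ₗ[ℝ] Vec (m + 2))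
        (Pi.single (Fin.last (m + 1)) 1)) = _ from h2] at h3
      simp at h3
      linarith

theorem gam0_cocompact (m : ℕ) (Γ : Subgroup (AffGroup (m + 2)))
    (hSim : ∀ γ ∈ Γ, InSimL m γ) (hCC : CocompactAction Γ) :
    CocompactAction (gam0 m Γ hSim) := by
  obtain ⟨K, hK, hcov⟩ := hCC
  have hdich : ∀ γ ∈ Γ, γ ∉ gam0 m Γ hSim → ∀ x ∈ fCone m, -γ.linear x ∈ fCone m := by
    intro γ hγ hn
    obtain ⟨μ, hμ, hQ⟩ := sim_scale (hSim _ hγ)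
    rcases cone_dichotomy (γ.linear : Vec (m + 2) →ₗ[ℝ] Vec (m + 2)) μ hμ hQ with h | h
    · exact absurd ⟨hγ, h⟩ hn
    · exact h
  by_cases hall : ∀ γ ∈ Γ, γ ∈ gam0 m Γ hSim
  · exact ⟨K, hK, fun x => by
      obtain ⟨γ, hγ, h⟩ := hcov x
      exact ⟨γ, hall γ hγ, h⟩⟩
  · push Not at hall
    obtain ⟨γ0, hγ0, hn0⟩ := hall
    refine ⟨K ∪ γ0 '' K, hK.union (hK.image (act_cont (⟨γ0, hγ0⟩ : Γ)).continuous), fun x => ?_⟩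
    obtain ⟨γ, hγ, h⟩ := hcov x
    by_cases hm : γ ∈ gam0 m Γ hSim
    · exact ⟨γ, hm, Or.inl h⟩
    · refine ⟨γ0 * γ, ⟨Γ.mul_mem hγ0 hγ, fun y hy => ?_⟩, Or.inr ⟨γ x, h, rfl⟩⟩
      have h1 := hdich γ0 hγ0 hn0 _ (hdich γ hγ hm y hy)
      rw [map_neg, neg_neg] at h1
      exact h1

theorem pdc_lorentz (m : ℕ) (Γ : Subgroup (AffGroup (m + 2)))
    (hSim : ∀ γ ∈ Γ, InSimL m γ) (hDisc : DiscreteTopology (POfGamma m Γ))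
    (hΔ : ∀ γ ∈ Γ, (∃ lam : ℝ, 0 < lam ∧ ∀ v : Vec (m + 2), γ.linear v = lam • v) → γ = 1)
    (S : Set (Vec (m + 2))) (hSC : S ⊆ fCone m) (hS : IsCompact S) :
    {γ : gam0 m Γ hSim | ∃ y ∈ S, ∃ c : ℝ, 0 < c ∧ c • linP γ y ∈ S}.Finite := by
  have hsc : ∀ γ : gam0 m Γ hSim, ∃ μ : ℝ, 0 < μ ∧
      ∀ v, lorentzQ m (linP γ v) = μ ^ 2 * lorentzQ m v := fun γ => sim_scale (hSim _ γ.2.1)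
  choose lam hlam hQ using hsc
  set A : gam0 m Γ hSim → Matrix (Fin (m + 2)) (Fin (m + 2)) ℝ := fun γ =>
    LinearMap.toMatrix' ((lam γ)⁻¹ • (linP γ : Vec (m + 2) →ₗ[ℝ] Vec (m + 2))) with hA
  set A' : gam0 m Γ hSim → Matrix (Fin (m + 2)) (Fin (m + 2)) ℝ := fun γ =>
    LinearMap.toMatrix' ((lam γ) • (linP γ⁻¹ : Vec (m + 2) →ₗ[ℝ] Vec (m + 2))) with hA'
  have hAv : ∀ γ v, (A γ).mulVec v = (lam γ)⁻¹ • linP γ v := by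
    intro γ v
    rw [hA, LinearMap.toMatrix'_mulVec]; rfl
  have hA'v : ∀ γ v, (A' γ).mulVec v = (lam γ) • linP γ⁻¹ v := by
    intro γ v
    rw [hA', LinearMap.toMatrix'_mulVec]; rfl
  have hinvL : ∀ (γ : gam0 m Γ hSim) v, linP γ⁻¹ (linP γ v) = v := by
    intro γ v; rw [← linP_mul, inv_mul_cancel, linP_one]
  have hLinv : ∀ (γ : gam0 m Γ hSim) v, linP γ (linP γ⁻¹ v) = v := by
    intro γ v; rw [← linP_mul, mul_inv_cancel, linP_one]
  have hext : ∀ M N : Matrix (Fin (m + 2)) (Fin (m + 2)) ℝ,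
      (∀ v, M.mulVec v = N.mulVec v) → M = N := by
    intro M N h
    apply Matrix.toLin'.injective
    refine LinearMap.ext fun v => ?_
    rw [Matrix.toLin'_apply, Matrix.toLin'_apply, h]
  have hA'A : ∀ γ, A' γ * A γ = 1 := by
    intro γ
    apply hext
    intro v
    rw [← Matrix.mulVec_mulVec, hAv, hA'v, map_smul, hinvL, smul_smul,
      mul_inv_cancel₀ (hlam γ).ne', one_smul, Matrix.one_mulVec]
  have hAA' : ∀ γ, A γ * A' γ = 1 := fun γ => mul_eq_one_comm.1 (hA'A γ)
  have hQA : ∀ γ v, lorentzQ m ((A γ).mulVec v) = lorentzQ m v := by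
    intro γ v
    have := (hlam γ).ne'
    rw [hAv, lorentzQ_smul, hQ]; field_simp
  have hQA' : ∀ γ v, lorentzQ m ((A' γ).mulVec v) = lorentzQ m v := by
    intro γ v
    rw [← hQA γ ((A' γ).mulVec v), Matrix.mulVec_mulVec, hAA', Matrix.one_mulVec]
  have hmemP : ∀ γ δ, A' γ * A δ ∈ POfGamma m Γ := by
    intro γ δ
    refine ⟨fun v => by rw [← Matrix.mulVec_mulVec, hQA', hQA], ((γ⁻¹ * δ : gam0 m Γ hSim) : _),
      (γ⁻¹ * δ).2.1, (lam γ)⁻¹ * lam δ, mul_pos (inv_pos.2 (hlam γ)) (hlam δ), fun v => ?_⟩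
    rw [← Matrix.mulVec_mulVec, hAv, hA'v, map_smul, smul_smul, smul_smul]
    have e1 : (lam γ)⁻¹ * lam δ * lam γ * (lam δ)⁻¹ = 1 := by
      have := (hlam γ).ne'
      have := (hlam δ).ne'
      field_simp
    rw [e1, one_smul, ← linP_mul]; rfl
  have hinjA : ∀ γ δ, A γ = A δ → γ = δ := by
    intro γ δ h
    have : ((γ⁻¹ * δ : gam0 m Γ hSim) : AffGroup (m + 2)) = 1 := by
      refine hΔ _ (γ⁻¹ * δ).2.1 ⟨(lam γ)⁻¹ * lam δ,
        mul_pos (inv_pos.2 (hlam γ)) (hlam δ), fun v => ?_⟩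
      have h1 : linP δ v = (lam δ * (lam γ)⁻¹) • linP γ v := by
        have h2 := hAv δ v
        rw [← h, hAv] at h2
        rw [mul_smul, h2, smul_smul, mul_inv_cancel₀ (hlam δ).ne', one_smul]
      change linP (γ⁻¹ * δ) v = _
      rw [linP_mul, h1, map_smul, hinvL, mul_comm]
    have h3 : γ⁻¹ * δ = 1 := Subtype.ext this
    exact (inv_mul_eq_one.1 h3)
  -- a neighbourhood of 1
  have h1P : (1 : Matrix (Fin (m + 2)) (Fin (m + 2)) ℝ) ∈ POfGamma m Γ := by
    have := hmemP 1 1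
    rwa [hA'A] at this
  obtain ⟨U, hU, hU1⟩ := (discreteTopology_subtype_iff'.1 hDisc) 1 h1P
  have hU1' : (1 : Matrix (Fin (m + 2)) (Fin (m + 2)) ℝ) ∈ U := by
    have : (1 : Matrix (Fin (m + 2)) (Fin (m + 2)) ℝ) ∈ U ∩ POfGamma m Γ := by rw [hU1]; rfl
    exact this.1
  -- bounds
  obtain ⟨D, hD⟩ := bd_cone hS hSC
  obtain ⟨b, hb⟩ := (hS.image (lorentzQ_cont m).neg).bddAbove
  have hci : ContinuousOn (fun y => (-lorentzQ m y)⁻¹) S :=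
    (lorentzQ_cont m).neg.continuousOn.inv₀ fun y hy => by
      have := (hSC hy).1
      exact (neg_pos.2 this).ne'
  obtain ⟨a, ha⟩ := (hS.image_of_continuousOn hci).bddAbove
  set κ := 1 + a * b with hκ
  set T : Set (Matrix (Fin (m + 2)) (Fin (m + 2)) ℝ) :=
    Set.pi univ fun _ => Set.pi univ fun _ => Set.Icc (-(κ * D)) (κ * D) with hT
  have hTc : IsCompact T := isCompact_univ_pi fun _ => isCompact_univ_pi fun _ => isCompact_Icc
  set Φ : gam0 m Γ hSim → Matrix (Fin (m + 2)) (Fin (m + 2)) ℝ ×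
    Matrix (Fin (m + 2)) (Fin (m + 2)) ℝ := fun γ => (A γ, A' γ) with hΦ
  have hΦinj : Function.Injective Φ := fun γ δ h => hinjA γ δ (congrArg Prod.fst h)
  set W := {γ : gam0 m Γ hSim | ∃ y ∈ S, ∃ c : ℝ, 0 < c ∧ c • linP γ y ∈ S} with hW
  have hWT : Φ '' W ⊆ T ×ˢ T := by
    rintro _ ⟨γ, ⟨y, hy, c, hc, hz⟩, rfl⟩
    have hμ : 0 < c * lam γ := mul_pos hc (hlam γ)
    have hy1 : 0 < -lorentzQ m y := neg_pos.2 (hSC hy).1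
    have hz1 : 0 < -lorentzQ m (c • linP γ y) := neg_pos.2 (hSC hz).1
    have hrel : -lorentzQ m (c • linP γ y) = (c * lam γ) ^ 2 * (-lorentzQ m y) := by
      rw [lorentzQ_smul, hQ]; ring
    have by1 : -lorentzQ m y ≤ b := hb ⟨y, hy, rfl⟩
    have bz1 : -lorentzQ m (c • linP γ y) ≤ b := hb ⟨_, hz, rfl⟩
    have ay1 : (-lorentzQ m y)⁻¹ ≤ a := ha ⟨y, hy, rfl⟩
    have az1 : (-lorentzQ m (c • linP γ y))⁻¹ ≤ a := ha ⟨_, hz, rfl⟩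
    have ha0 : 0 ≤ a := (inv_pos.2 hy1).le.trans ay1
    have hyne : lorentzQ m y ≠ 0 := (hSC hy).1.ne
    have hcne := hc.ne'
    have hlne := (hlam γ).ne'
    have k1 : (c * lam γ) ^ 2 ≤ a * b := by
      calc (c * lam γ) ^ 2 = (-lorentzQ m y)⁻¹ * (-lorentzQ m (c • linP γ y)) := by
            rw [hrel]; field_simp
        _ ≤ a * b := mul_le_mul ay1 bz1 hz1.le ha0
    have k2 : ((c * lam γ)⁻¹) ^ 2 ≤ a * b := by
      calc ((c * lam γ)⁻¹) ^ 2 = (-lorentzQ m (c • linP γ y))⁻¹ * (-lorentzQ m y) := by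
            rw [hrel]; field_simp
        _ ≤ a * b := mul_le_mul az1 by1 hy1.le ha0
    have k1' : c * lam γ ≤ κ := by nlinarith [sq_nonneg (c * lam γ - 1)]
    have k2' : (c * lam γ)⁻¹ ≤ κ := by nlinarith [sq_nonneg ((c * lam γ)⁻¹ - 1)]
    have hi : 0 < (c * lam γ)⁻¹ := inv_pos.2 hμ
    have d1 := hD (c • (linP γ : Vec (m + 2) →ₗ[ℝ] Vec (m + 2)))
      (fun x hx => fCone_smul c hc _ (γ.2.2 x hx)) y hy hz
    have d2 := hD (c⁻¹ • (linP γ⁻¹ : Vec (m + 2) →ₗ[ℝ] Vec (m + 2)))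
      (fun x hx => fCone_smul _ (inv_pos.2 hc) _ ((γ⁻¹).2.2 x hx)) _ hz (by
        change c⁻¹ • linP γ⁻¹ (c • linP γ y) ∈ S
        rw [map_smul, hinvL, smul_smul, inv_mul_cancel₀ hc.ne', one_smul]; exact hy)
    refine ⟨fun i _ j _ => ?_, fun i _ j _ => ?_⟩
    · have e1 : A γ i j = (c * lam γ)⁻¹ * (c * linP γ (Pi.single j 1) i) := by
        simp only [hA, LinearMap.toMatrix'_apply, LinearMap.smul_apply, Pi.smul_apply, smul_eq_mul]
        rw [mul_inv, mul_comm c⁻¹, mul_assoc, inv_mul_cancel_left₀ hc.ne']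
        rfl
      refine abs_le.1 (?_ : |A γ i j| ≤ κ * D)
      rw [e1, abs_mul, abs_of_pos hi]
      exact mul_le_mul k2' (d1 i j) (abs_nonneg _) (hi.le.trans k2')
    · have e1 : A' γ i j = (c * lam γ) * (c⁻¹ * linP γ⁻¹ (Pi.single j 1) i) := by
        simp only [hA', LinearMap.toMatrix'_apply, LinearMap.smul_apply, Pi.smul_apply, smul_eq_mul]
        rw [mul_comm c, mul_assoc, mul_inv_cancel_left₀ hc.ne']
        rfl
      refine abs_le.1 (?_ : |A' γ i j| ≤ κ * D)
      rw [e1, abs_mul, abs_of_pos hμ]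
      exact mul_le_mul k1' (d2 i j) (abs_nonneg _) (hμ.le.trans k1')
  by_contra hinf
  have hinf' : (Φ '' W).Infinite := (Set.Infinite.image hΦinj.injOn hinf)
  obtain ⟨p, -, hp⟩ := hinf'.exists_accPt_of_subset_isCompact (hTc.prod hTc) hWT
  have hpcl : p ∈ closure (Φ '' W) := mem_closure_iff_clusterPt.2 hp.clusterPt
  have hp1 : p.2 * p.1 = 1 := by
    have hcl : IsClosed {q : Matrix (Fin (m + 2)) (Fin (m + 2)) ℝ ×
      Matrix (Fin (m + 2)) (Fin (m + 2)) ℝ | q.2 * q.1 = 1} :=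
      isClosed_eq (continuous_snd.mul continuous_fst) continuous_const
    refine closure_minimal ?_ hcl hpcl
    rintro _ ⟨γ, -, rfl⟩
    exact hA'A γ
  have hcont : Continuous (fun q : (Matrix (Fin (m + 2)) (Fin (m + 2)) ℝ ×
      Matrix (Fin (m + 2)) (Fin (m + 2)) ℝ) × (Matrix (Fin (m + 2)) (Fin (m + 2)) ℝ ×
      Matrix (Fin (m + 2)) (Fin (m + 2)) ℝ) => q.1.2 * q.2.1) :=
    (continuous_snd.comp continuous_fst).mul (continuous_fst.comp continuous_snd)
  have hnh : ∀ᶠ q in 𝓝 p ×ˢ 𝓝 p, q.1.2 * q.2.1 ∈ U := by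
    rw [← nhds_prod_eq]
    refine hcont.continuousAt.eventually_mem ?_
    simp only [hp1]
    exact hU.mem_nhds hU1'
  obtain ⟨V, hV, hVU⟩ := Filter.eventually_prod_self_iff'.1 hnh
  have hacc : AccPt p (𝓟 (V ∩ Φ '' W)) := hp.nhds_inter hV
  have hinf2 : (V ∩ Φ '' W).Infinite := Set.Infinite.of_accPt hacc
  obtain ⟨_, ⟨hq1, ⟨γ, -, rfl⟩⟩, _, ⟨hq2, ⟨δ, -, rfl⟩⟩, hne⟩ := hinf2.nontrivial
  apply hne
  have h5 : A' γ * A δ ∈ U ∩ POfGamma m Γ := ⟨hVU _ hq1 _ hq2, hmemP γ δ⟩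
  rw [hU1, Set.mem_singleton_iff] at h5
  have h6 : A δ = A γ := by
    calc A δ = (A γ * A' γ) * A δ := by rw [hAA', one_mul]
      _ = A γ * (A' γ * A δ) := mul_assoc _ _ _
      _ = A γ := by rw [h5, mul_one]
  rw [hinjA _ _ h6]


/-- If `Γ ≤ Sim_L(ℝ^{m+2})` acts freely, properly discontinuously and cocompactly on
`ℝ^{m+2}` and `P(Γ)` is discrete in `O(m+1,1)`, then `Δ = Γ ∩ (ℝ^{m+2} ⋊ ℝ^+)` is a
nontrivial group consisting of pure translations. -/
theorem statement1 (m : ℕ) (Γ : Subgroup (AffGroup (m + 2)))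
    (hSim : ∀ γ ∈ Γ, InSimL m γ)
    (hFree : FreeAction Γ) (hPD : ProperlyDisc Γ) (hCC : CocompactAction Γ)
    (hDisc : DiscreteTopology (POfGamma m Γ)) :
    (∃ γ ∈ Γ, γ ≠ 1 ∧ ∃ lam : ℝ, 0 < lam ∧ ∀ v : Vec (m + 2), γ.linear v = lam • v) ∧
    (∀ γ ∈ Γ, (∃ lam : ℝ, 0 < lam ∧ ∀ v : Vec (m + 2), γ.linear v = lam • v) →
      ∃ a : Vec (m + 2), ∀ x : Vec (m + 2), γ x = x + a) := by
  constructor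
  · by_contra hcon
    have hΔ : ∀ γ ∈ Γ, (∃ lam : ℝ, 0 < lam ∧ ∀ v : Vec (m + 2), γ.linear v = lam • v) →
        γ = 1 := by
      intro γ hγ h
      by_contra hne
      exact hcon ⟨γ, hγ, hne, h⟩
    exact lemmaC (gam0 m Γ hSim) (fCone m) (ContinuousLinearMap.proj (Fin.last (m + 1)))
      (fCone_open m) fCone_add fCone_smul _ (eCone m) (fun x hx => hx.2)
      (fun γ x hx => γ.2.2 x hx) (fun S hSC hS => pdc_lorentz m Γ hSim hDisc hΔ S hSC hS)
      (fun K hK => (hPD K hK).subset fun γ h => ⟨h.1.1, h.2⟩) (gam0_cocompact m Γ hSim hCC)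
  · rintro γ hγ ⟨lam, hlam, h⟩
    have hact : ∀ x, γ x = lam • x + γ 0 := fun x => by
      rw [← h]; exact act_eq (⟨γ, hγ⟩ : Γ) x
    by_cases h1 : lam = 1
    · exact ⟨γ 0, fun x => by rw [hact, h1, one_smul]⟩
    · have h2 : (1 - lam) ≠ 0 := sub_ne_zero.2 (Ne.symm h1)
      have hg : γ = 1 := by
        refine hFree γ hγ ⟨(1 - lam)⁻¹ • γ 0, ?_⟩
        rw [hact]
        ext i
        simp only [Pi.add_apply, Pi.smul_apply, smul_eq_mul]
        field_simp
        ring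
      exact ⟨0, fun x => by rw [hg, add_zero]; rfl⟩
end
end

section
/- Let Γ ≤ E(3,1) = ℝ^4 ⋊ O(3,1) act freely, properly discontinuously and cocompactly on ℝ^4, and suppose Γ contains a central nontrivial pure translation x ↦ x + v by a timelike vector v (Q(v) < 0). Then Γ has a finite-index subgroup consisting entirely of pure translations; in particular ℝ^4/Γ is finitely covered by a torus T^4. -/
noncomputable section

section Bieb
variable {V : Type*} [NormedAddCommGroup V] [InnerProductSpace ℝ V] [FiniteDimensional ℝ V]

/-- The linear part minus the identity. -/
noncomputable def devi (A : V ≃ₗᵢ[ℝ] V) : V →L[ℝ] V :=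
  (A.toContinuousLinearEquiv : V →L[ℝ] V) - ContinuousLinearMap.id ℝ V

theorem devi_apply (A : V ≃ₗᵢ[ℝ] V) (x : V) : devi A x = A x - x := by
  simp [devi]

theorem devi_le (A : V ≃ₗᵢ[ℝ] V) (x : V) : ‖A x - x‖ ≤ ‖devi A‖ * ‖x‖ := by
  rw [← devi_apply]; exact (devi A).le_opNorm x

theorem exists_norm_attained (T : V →L[ℝ] V) (h : 0 < ‖T‖) :
    ∃ u : V, ‖u‖ = 1 ∧ ‖T u‖ = ‖T‖ := by
  have hne : (Metric.sphere (0 : V) 1).Nonempty := by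
    by_contra hcon
    have : T = 0 := by
      ext x
      by_contra hx
      have hx0 : x ≠ 0 := by rintro rfl; simp at hx
      apply hcon
      refine ⟨(‖x‖⁻¹) • x, ?_⟩
      simp [norm_smul, hx0]
    simp [this] at h
  obtain ⟨u, hu, hmax⟩ := (isCompact_sphere (0 : V) 1).exists_isMaxOn hne
    (f := fun x => ‖T x‖) (by fun_prop)
  have hu1 : ‖u‖ = 1 := by simpa using hu
  refine ⟨u, hu1, le_antisymm ?_ ?_⟩
  · simpa [hu1] using T.le_opNorm u
  · refine T.opNorm_le_bound (norm_nonneg _) fun x => ?_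
    by_cases hx0 : x = 0
    · simp [hx0]
    have := hmax (a := (‖x‖⁻¹) • x) (by simp [norm_smul, hx0])
    simp only [Set.mem_ofPred_eq, map_smul, norm_smul, norm_inv, norm_norm] at this
    have hx : 0 < ‖x‖ := norm_pos_iff.2 hx0
    rwa [inv_mul_le_iff₀ hx, mul_comm] at this

theorem le_of_sq_le_sq_aux {a b : ℝ} (h : a ^ 2 ≤ b ^ 2) (hb : 0 ≤ b) : a ≤ b :=
  (le_abs_self a).trans (abs_le_of_sq_le_sq h hb)

theorem spectral (A : V ≃ₗᵢ[ℝ] V) (hA : 0 < ‖devi A‖) :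
    ∃ (p : V →L[ℝ] V) (k : ℝ), 0 ≤ k ∧ k < ‖devi A‖ ∧
      (∀ x, ‖p x‖ ≤ ‖x‖) ∧ (∀ x, ‖x - p x‖ ≤ ‖x‖) ∧
      (∀ x, p (A x - x) = A (p x) - p x) ∧
      (∀ x, ‖A (p x) - p x‖ = ‖devi A‖ * ‖p x‖) ∧
      (∀ x, ‖A (x - p x) - (x - p x)‖ ≤ k * ‖x - p x‖) ∧
      ∃ u, ‖u‖ = 1 ∧ p u = u := by
  set m := ‖devi A‖ with hm
  let P : V →ₗ[ℝ] V := (2 : ℝ) • LinearMap.id - (A.toLinearEquiv : V →ₗ[ℝ] V)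
    - (A.symm.toLinearEquiv : V →ₗ[ℝ] V)
  have hP : ∀ x, P x = (2 : ℝ) • x - A x - A.symm x := fun x => by simp [P]
  have hPn : ∀ x, ‖P x‖ ≤ m ^ 2 * ‖x‖ := by
    intro x
    have h1 : A (P x) = -(A (A x - x) - (A x - x)) := by
      rw [hP]; simp only [map_sub, map_smul, LinearIsometryEquiv.apply_symm_apply]; module
    have h2 : ‖P x‖ = ‖A (A x - x) - (A x - x)‖ := by
      rw [← A.norm_map, h1, norm_neg]
    rw [h2]
    calc _ ≤ m * ‖A x - x‖ := devi_le A _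
      _ ≤ m * (m * ‖x‖) := by gcongr; exact devi_le A _
      _ = _ := by ring
  have hadj : ∀ x y, inner ℝ (A x) y = inner ℝ x (A.symm y) := by
    intro x y
    rw [← A.inner_map_map x (A.symm y)]; simp
  have hPi : ∀ x, inner ℝ (P x) x = ‖A x - x‖ ^ 2 := by
    intro x
    have h3 : inner ℝ (A.symm x) x = inner ℝ (A x) x := by
      rw [hadj, real_inner_comm]
    rw [hP, norm_sub_sq_real, A.norm_map, inner_sub_left, inner_sub_left, h3, real_inner_smul_left,
      real_inner_self_eq_norm_sq]; ring
  let E : Submodule ℝ V := LinearMap.ker (P - (m ^ 2) • LinearMap.id)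
  have hE : ∀ x, x ∈ E ↔ P x = m ^ 2 • x := by
    intro x; simp [E, sub_eq_zero]
  have hE1 : ∀ x ∈ E, ‖A x - x‖ = m * ‖x‖ := by
    intro x hx
    have := hPi x
    rw [(hE x).1 hx, real_inner_smul_left, real_inner_self_eq_norm_sq] at this
    have h4 : ‖A x - x‖ ^ 2 = (m * ‖x‖) ^ 2 := by rw [← this]; ring
    exact (pow_left_inj₀ (norm_nonneg _) (by positivity) two_ne_zero).1 h4
  have hE2 : ∀ x, ‖A x - x‖ = m * ‖x‖ → x ∈ E := by
    intro x hx
    rw [hE, ← sub_eq_zero, ← norm_eq_zero]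
    have h5 := norm_sub_sq_real (P x) (m ^ 2 • x)
    rw [real_inner_smul_right, hPi, hx, norm_smul, Real.norm_of_nonneg (by positivity)] at h5
    have h6 : ‖P x‖ ^ 2 ≤ (m ^ 2 * ‖x‖) ^ 2 := by gcongr; exact hPn x
    have h7 : ‖P x - m ^ 2 • x‖ ^ 2 ≤ 0 := by rw [h5]; nlinarith
    have := sq_nonneg ‖P x - m ^ 2 • x‖
    exact pow_eq_zero_iff two_ne_zero |>.1 (le_antisymm h7 this)
  have hEA : ∀ x ∈ E, A x ∈ E := by
    intro x hx
    rw [hE] at hx ⊢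
    rw [← map_smul, ← hx, hP, hP]; simp
  have hEAs : ∀ x ∈ E, A.symm x ∈ E := by
    intro x hx
    rw [hE] at hx ⊢
    rw [← map_smul, ← hx, hP, hP]; simp
  have hEo : ∀ x ∈ Eᗮ, A x ∈ Eᗮ := by
    intro x hx
    rw [Submodule.mem_orthogonal'] at hx ⊢
    intro y hy
    rw [hadj]; exact hx _ (hEAs y hy)
  obtain ⟨k, hk0, hkm, hk⟩ : ∃ k : ℝ, 0 ≤ k ∧ k < m ∧ ∀ x ∈ Eᗮ, ‖A x - x‖ ≤ k * ‖x‖ := by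
    have hlt : ∀ x ∈ Eᗮ, ‖x‖ = 1 → ‖A x - x‖ < m := by
      intro x hx h1
      refine lt_of_le_of_ne (by simpa [h1] using devi_le A x) fun h => ?_
      have hxE := hE2 x (by rw [h, h1, mul_one])
      have : inner ℝ x x = 0 := (Submodule.mem_orthogonal' _ _).1 hx x hxE
      rw [inner_self_eq_zero] at this
      simp [this] at h1
    have hcpt : IsCompact (Metric.sphere (0 : V) 1 ∩ (Eᗮ : Set V)) :=
      (isCompact_sphere (0 : V) 1).inter_right Eᗮ.closed_of_finiteDimensional
    have hscale : ∀ k : ℝ, (∀ x ∈ Eᗮ, ‖x‖ = 1 → ‖A x - x‖ ≤ k) →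
        ∀ x ∈ Eᗮ, ‖A x - x‖ ≤ k * ‖x‖ := by
      intro k hk x hx
      by_cases hx0 : x = 0
      · simp [hx0]
      have hxp : 0 < ‖x‖ := norm_pos_iff.2 hx0
      have := hk (‖x‖⁻¹ • x) (Submodule.smul_mem _ _ hx) (by simp [norm_smul, hx0])
      rw [map_smul, ← smul_sub, norm_smul, norm_inv, norm_norm] at this
      rwa [inv_mul_le_iff₀ hxp, mul_comm] at this
    rcases (Metric.sphere (0 : V) 1 ∩ (Eᗮ : Set V)).eq_empty_or_nonempty with he | hne
    · refine ⟨0, le_rfl, hA, hscale 0 fun x hx h1 => ?_⟩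
      have : x ∈ (Metric.sphere (0 : V) 1 ∩ (Eᗮ : Set V)) := ⟨by simpa using h1, hx⟩
      rw [he] at this; exact this.elim
    · obtain ⟨x0, hx0, hmax⟩ := hcpt.exists_isMaxOn hne
        (f := fun x => ‖A x - x‖) (by fun_prop)
      refine ⟨‖A x0 - x0‖, norm_nonneg _, hlt x0 hx0.2 (by simpa using hx0.1),
        hscale _ fun x hx h1 => hmax (a := x) ⟨by simpa using h1, hx⟩⟩
  have hp1 : ∀ x, E.starProjection x ∈ E := fun x => by simp
  have hp2 : ∀ x, x - E.starProjection x ∈ Eᗮ := fun x => E.sub_starProjection_mem_orthogonal x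
  have hpyth : ∀ x, ‖x‖ ^ 2 = ‖E.starProjection x‖ ^ 2 + ‖x - E.starProjection x‖ ^ 2 := by
    intro x
    have h := norm_add_sq_real (E.starProjection x) (x - E.starProjection x)
    rw [(Submodule.mem_orthogonal _ _).1 (hp2 x) _ (hp1 x)] at h
    simpa using h
  refine ⟨E.starProjection, k, hk0, hkm, fun x => ?_, fun x => ?_, fun x => ?_,
    fun x => hE1 _ (hp1 x), fun x => hk _ (hp2 x), ?_⟩
  · have := hpyth x
    exact le_of_sq_le_sq_aux (by nlinarith [sq_nonneg ‖x - E.starProjection x‖]) (norm_nonneg _)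
  · have := hpyth x
    exact le_of_sq_le_sq_aux (by nlinarith [sq_nonneg ‖E.starProjection x‖]) (norm_nonneg _)
  · have h1 : A (E.starProjection x) - E.starProjection x ∈ E := sub_mem (hEA _ (hp1 x)) (hp1 x)
    have h2 : (A x - x) - (A (E.starProjection x) - E.starProjection x) ∈ Eᗮ := by
      have := sub_mem (hEo _ (hp2 x)) (hp2 x)
      rw [map_sub] at this
      convert this using 1; abel
    exact Submodule.eq_starProjection_of_mem_orthogonal h1 h2
  · obtain ⟨u, hu, hTu⟩ := exists_norm_attained (devi A) hA
    refine ⟨u, hu, ?_⟩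
    have : u ∈ E := hE2 u (by rw [← devi_apply, hTu, hu, mul_one])
    exact Submodule.starProjection_eq_self_iff.2 this

variable {G : Type*} [Group G] (L : G →* (V ≃ₗᵢ[ℝ] V)) (c : G → V)

theorem step1 (hc : ∀ g h, c (g * h) = c g + L g (c h)) (d : ℝ)
    (hd : ∀ x, ∃ g, ‖c g - x‖ ≤ d) (u : V) (hu : ‖u‖ = 1) (ε δ : ℝ) (hε : 0 < ε) (hδ : 0 < δ) :
    ∃ (g : G) (s : ℝ), 0 < s ∧ ‖c g - s • u‖ ≤ δ * s ∧ ‖devi (L g)‖ ≤ ε := by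
  choose g hg using fun n : ℕ => hd ((n : ℝ) • u)
  let f : ℕ → (V →L[ℝ] V) := fun n => ((L (g n)).toContinuousLinearEquiv : V →L[ℝ] V)
  have hf : ∀ n, f n ∈ Metric.closedBall (0 : V →L[ℝ] V) 1 := by
    intro n
    rw [mem_closedBall_zero_iff]
    exact ContinuousLinearMap.opNorm_le_bound _ zero_le_one fun x => by simp [f]
  obtain ⟨a, -, φ, hφ, hlim⟩ := (isCompact_closedBall (0 : V →L[ℝ] V) 1).tendsto_subseq hf
  obtain ⟨N, hN⟩ := Metric.cauchySeq_iff.1 hlim.cauchySeq ε hε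
  set i := φ N
  obtain ⟨M, hM⟩ := exists_nat_gt ((d + ‖c (g i)‖) / δ)
  set n := max N (M + 1)
  set j := φ n
  have hj : M + 1 ≤ j := (le_max_right _ _).trans hφ.le_apply
  have hj' : (M : ℝ) + 1 ≤ j := by exact_mod_cast hj
  have hjp : (0 : ℝ) < j := by
    have : (0 : ℝ) ≤ M := Nat.cast_nonneg M
    linarith
  have hinv : c (g i)⁻¹ = -(L (g i)).symm (c (g i)) := by
    have h1 : c 1 = 0 := by simpa using hc 1 1
    have h2 := hc (g i)⁻¹ (g i)
    rw [inv_mul_cancel, h1, map_inv] at h2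
    exact eq_neg_of_add_eq_zero_left h2.symm
  refine ⟨g j * (g i)⁻¹, j, hjp, ?_, ?_⟩
  · have h3 : c (g j * (g i)⁻¹) - (j : ℝ) • u
        = (c (g j) - (j : ℝ) • u) - L (g j) ((L (g i)).symm (c (g i))) := by
      rw [hc, hinv, map_neg]; abel
    rw [h3]
    have h4 : d + ‖c (g i)‖ < M * δ := (div_lt_iff₀ hδ).1 hM
    calc _ ≤ ‖c (g j) - (j : ℝ) • u‖ + ‖L (g j) ((L (g i)).symm (c (g i)))‖ := norm_sub_le _ _
      _ ≤ d + ‖c (g i)‖ := by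
        gcongr
        · exact hg j
        · simp
      _ ≤ δ * j := by nlinarith
  · have h5 : ‖f j - f i‖ < ε := by
      rw [← dist_eq_norm]; exact hN n (le_max_left _ _) N le_rfl
    refine le_trans ?_ h5.le
    refine ContinuousLinearMap.opNorm_le_bound _ (norm_nonneg _) fun x => ?_
    have h6 : devi (L (g j * (g i)⁻¹)) x = (f j - f i) ((L (g i)).symm x) := by
      rw [devi_apply, map_mul, map_inv]
      simp [f]
    rw [h6]
    simpa using (f j - f i).le_opNorm ((L (g i)).symm x)

theorem exists_min (hfin : ∀ R : ℝ, {g | ‖c g‖ ≤ R}.Finite) (p : G → Prop) (hp : ∃ g, p g) :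
    ∃ g, p g ∧ ∀ h, p h → ‖c g‖ ≤ ‖c h‖ := by
  obtain ⟨g0, h0⟩ := hp
  obtain ⟨g, hg, hmin⟩ := Set.exists_min_image {g | ‖c g‖ ≤ ‖c g0‖ ∧ p g} (fun g => ‖c g‖)
    ((hfin ‖c g0‖).subset fun g hg => hg.1) ⟨g0, le_rfl, h0⟩
  refine ⟨g, hg.2, fun h hh => ?_⟩
  by_cases hle : ‖c h‖ ≤ ‖c g0‖
  · exact hmin h ⟨hle, hh⟩
  · exact hg.1.trans (not_le.1 hle).le

theorem devi_comm (A B : V ≃ₗᵢ[ℝ] V) :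
    ‖devi (A * B * A⁻¹ * B⁻¹)‖ ≤ 2 * ‖devi A‖ * ‖devi B‖ := by
  refine ContinuousLinearMap.opNorm_le_bound _ (by positivity) fun x => ?_
  set y := A⁻¹ (B⁻¹ x) with hy
  have hx : x = B (A y) := by
    have h1 : B (B⁻¹ x) = x := B.apply_symm_apply x
    have h2 : A y = B⁻¹ x := A.apply_symm_apply _
    rw [h2, h1]
  have hn : ‖y‖ = ‖x‖ := by rw [hx]; simp
  have h3 : devi (A * B * A⁻¹ * B⁻¹) x = A (B y) - B (A y) := by
    rw [devi_apply, ← hx]; rfl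
  have h4 : A (B y) - B (A y) = (A (B y - y) - (B y - y)) - (B (A y - y) - (A y - y)) := by
    simp only [map_sub]; abel
  rw [h3, h4, ← hn]
  calc _ ≤ ‖A (B y - y) - (B y - y)‖ + ‖B (A y - y) - (A y - y)‖ := norm_sub_le _ _
    _ ≤ ‖devi A‖ * (‖devi B‖ * ‖y‖) + ‖devi B‖ * (‖devi A‖ * ‖y‖) := by
      gcongr
      · exact (devi_le A _).trans (by gcongr; exact devi_le B _)
      · exact (devi_le B _).trans (by gcongr; exact devi_le A _)
    _ = _ := by ring

theorem step2 (hc : ∀ g h, c (g * h) = c g + L g (c h)) (d : ℝ)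
    (hd : ∀ x, ∃ g, ‖c g - x‖ ≤ d) (hfin : ∀ R : ℝ, {g | ‖c g‖ ≤ R}.Finite)
    (g : G) (hg : ‖devi (L g)‖ ≤ 1 / 2) : ‖devi (L g)‖ = 0 := by
  by_contra hne
  obtain ⟨α, ⟨hα0, hα⟩, hαmin⟩ := exists_min c hfin
    (fun g => 0 < ‖devi (L g)‖ ∧ ‖devi (L g)‖ ≤ 1 / 2)
    ⟨g, lt_of_le_of_ne (norm_nonneg _) (Ne.symm hne), hg⟩
  obtain ⟨p, k, hk0, hkm, hp1, hp2, hpc, hpm, hpk, u, hu, hpu⟩ := spectral (L α) hα0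
  set m := ‖devi (L α)‖ with hm
  obtain ⟨β, ⟨hβc, hβ⟩, hβmin⟩ := exists_min c hfin
    (fun g => ‖c g - p (c g)‖ < ‖p (c g)‖ ∧ ‖devi (L g)‖ ≤ (m - k) / 8) (by
      obtain ⟨g, s, hs, h1, h2⟩ := step1 L c hc d hd u hu ((m - k) / 8) (1 / 3)
        (by linarith) (by norm_num)
      refine ⟨g, ?_, h2⟩
      have h3 := hp1 (c g - s • u)
      have h4 := hp2 (c g - s • u)
      rw [map_sub, map_smul, hpu] at h3 h4
      have h5 : c g - s • u - (p (c g) - s • u) = c g - p (c g) := by abel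
      rw [h5] at h4
      have h6 : ‖s • u‖ - ‖p (c g) - s • u‖ ≤ ‖p (c g)‖ := by
        have := norm_sub_norm_le (s • u) (s • u - p (c g))
        rw [norm_sub_rev (s • u) (p (c g)), sub_sub_cancel] at this
        exact this
      rw [norm_smul, hu, Real.norm_of_nonneg hs.le] at h6
      linarith)
  set a := c α with ha
  set b := c β with hb
  set A := L α with hA
  set B := L β with hB
  set γ := α * β * α⁻¹ * β⁻¹ with hγ
  have hLγ : L γ = A * B * A⁻¹ * B⁻¹ := by simp [hγ, hA, hB]
  have hN : ‖devi (L γ)‖ ≤ ‖devi B‖ := by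
    rw [hLγ]
    refine (devi_comm A B).trans ?_
    nlinarith [norm_nonneg (devi B)]
  set r := (b - L γ b) + (a - L γ (B a)) with hr
  have hcγ : c γ = (A b - b) + r := by
    have h1 : γ * (β * α) = α * β := by rw [hγ]; group
    have h2 : c (γ * (β * α)) = c (α * β) := by rw [h1]
    rw [hc γ, hc β, hc α, map_add] at h2
    have h3 : c γ = a + A b - (L γ b + L γ (B a)) := eq_sub_of_add_eq h2
    rw [h3, hr]; abel
  have hr1 : ‖b - L γ b‖ ≤ ‖devi B‖ * ‖b‖ := by
    rw [norm_sub_rev]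
    exact (devi_le _ _).trans (by gcongr)
  have hr2 : ‖a - L γ (B a)‖ ≤ ‖devi B‖ * ‖a‖ := by
    have h1 : L γ (B a) = A (B (A.symm a)) := by
      have h0 : L γ * B = A * B * A⁻¹ := by rw [hLγ]; group
      exact congrArg (fun F : V ≃ₗᵢ[ℝ] V => F a) h0
    have h2 : a - L γ (B a) = A (A.symm a - B (A.symm a)) := by
      rw [h1, map_sub, A.apply_symm_apply]
    rw [h2, A.norm_map, norm_sub_rev]
    simpa using devi_le B (A.symm a)
  have hab : ‖devi B‖ * ‖a‖ ≤ ‖devi B‖ * ‖b‖ := by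
    rcases (norm_nonneg (devi B)).eq_or_lt with h0 | h0
    · rw [← h0]; simp
    · have := hαmin β ⟨h0, by linarith⟩
      gcongr
  have hrn : ‖r‖ ≤ (m - k) / 4 * ‖b‖ := by
    have h1 := norm_add_le (b - L γ b) (a - L γ (B a))
    nlinarith [norm_nonneg b]
  have hb2 : ‖b‖ < 2 * ‖p b‖ := by
    have := norm_add_le (p b) (b - p b)
    rw [add_sub_cancel] at this
    linarith
  have hb0 : 0 < ‖p b‖ := lt_of_le_of_lt (norm_nonneg _) hβc
  have hbpos : 0 < ‖b‖ := lt_of_lt_of_le hb0 (hp1 b)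
  have hr4 : 2 * ‖r‖ < (m - k) * ‖p b‖ := by nlinarith
  have hpγ : p (c γ) = (A (p b) - p b) + p r := by rw [hcγ, map_add, hpc]
  have hqγ : c γ - p (c γ) = (A (b - p b) - (b - p b)) + (r - p r) := by
    rw [hpγ, hcγ, map_sub]; abel
  have hlow : m * ‖p b‖ - ‖r‖ ≤ ‖p (c γ)‖ := by
    have h1 := norm_sub_le ((A (p b) - p b) + p r) (p r)
    rw [add_sub_cancel_right, hpm, ← hpγ] at h1
    linarith [hp1 r]
  have hup : ‖c γ - p (c γ)‖ ≤ k * ‖b - p b‖ + ‖r‖ := by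
    rw [hqγ]
    exact (norm_add_le _ _).trans (add_le_add (hpk b) (hp2 r))
  have hfinal := hβmin γ ⟨by nlinarith, hN.trans hβ⟩
  have hsm : ‖c γ‖ ≤ m * ‖b‖ + ‖r‖ := by
    rw [hcγ]
    exact (norm_add_le _ _).trans (add_le_add (devi_le A b) le_rfl)
  nlinarith

theorem bieb (hc : ∀ g h, c (g * h) = c g + L g (c h)) (d : ℝ)
    (hd : ∀ x, ∃ g, ‖c g - x‖ ≤ d) (hfin : ∀ R : ℝ, {g | ‖c g‖ ≤ R}.Finite) :
    L.ker.FiniteIndex := by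
  have hfr : Finite L.range := by
    by_contra hinf
    rw [not_finite_iff_infinite] at hinf
    let e := Infinite.natEmbedding L.range
    choose g hg using fun n => (e n).2
    let f : ℕ → (V →L[ℝ] V) := fun n => ((L (g n)).toContinuousLinearEquiv : V →L[ℝ] V)
    have hf : ∀ n, f n ∈ Metric.closedBall (0 : V →L[ℝ] V) 1 := by
      intro n
      rw [mem_closedBall_zero_iff]
      exact ContinuousLinearMap.opNorm_le_bound _ zero_le_one fun x => by simp [f]
    obtain ⟨a, -, φ, hφ, hlim⟩ := (isCompact_closedBall (0 : V →L[ℝ] V) 1).tendsto_subseq hf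
    obtain ⟨N, hN⟩ := Metric.cauchySeq_iff.1 hlim.cauchySeq (1 / 2) (by norm_num)
    have h5 := hN (N + 1) (Nat.le_succ _) N le_rfl
    rw [dist_eq_norm] at h5
    set i := φ N
    set j := φ (N + 1)
    have h6 : ∀ x, devi (L (g j * (g i)⁻¹)) x = (f j - f i) ((L (g i)).symm x) := by
      intro x
      rw [devi_apply, map_mul, map_inv]
      simp [f]
    have h7 : ‖devi (L (g j * (g i)⁻¹))‖ ≤ 1 / 2 := by
      refine le_trans ?_ h5.le
      refine ContinuousLinearMap.opNorm_le_bound _ (norm_nonneg _) fun x => ?_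
      rw [h6]
      simpa using (f j - f i).le_opNorm ((L (g i)).symm x)
    have h8 := step2 L c hc d hd hfin _ h7
    rw [norm_eq_zero] at h8
    have h9 : L (g j) = L (g i) := by
      rw [← mul_inv_eq_one, ← map_inv, ← map_mul]
      ext x
      have := devi_apply (L (g j * (g i)⁻¹)) x
      rw [h8] at this
      exact (sub_eq_zero.1 this.symm)
    rw [hg, hg] at h9
    have := e.injective (Subtype.ext h9)
    exact absurd (hφ.injective this) (Nat.succ_ne_self N)
  exact Subgroup.finiteIndex_ker L
end Bieb

theorem bieb_form {V : Type*} [AddCommGroup V] [Module ℝ V] [FiniteDimensional ℝ V]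
    (F : V →ₗ[ℝ] V →ₗ[ℝ] ℝ) (hsymm : ∀ x y, F x y = F y x) (hpos : ∀ x, x ≠ 0 → 0 < F x x)
    {G : Type*} [Group G] (L : G →* (V ≃ₗ[ℝ] V)) (c : G → V)
    (hL : ∀ g x y, F (L g x) (L g y) = F x y)
    (hc : ∀ g h, c (g * h) = c g + L g (c h)) (d : ℝ)
    (hd : ∀ x, ∃ g, F (c g - x) (c g - x) ≤ d)
    (hfin : ∀ R : ℝ, {g | F (c g) (c g) ≤ R}.Finite) : L.ker.FiniteIndex := by
  have hnn : ∀ x, 0 ≤ F x x := fun x => by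
    by_cases hx : x = 0
    · simp [hx]
    · exact (hpos x hx).le
  let core : InnerProductSpace.Core ℝ V :=
    { inner := fun x y => F x y
      conj_inner_symm := fun x y => by simpa using hsymm y x
      re_inner_nonneg := fun x => by simpa using hnn x
      add_left := fun x y z => by simp
      smul_left := fun x y r => by simp
      definite := fun x hx => by
        by_contra h
        exact (hpos x h).ne' hx }
  let _ : NormedAddCommGroup V := core.toNormedAddCommGroup
  let _ : InnerProductSpace ℝ V := InnerProductSpace.ofCore core.toCore
  have hinner : ∀ x y : V, inner ℝ x y = F x y := fun x y => rfl
  have hnorm : ∀ x : V, ‖x‖ ^ 2 = F x x := fun x => by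
    rw [← real_inner_self_eq_norm_sq, hinner]
  let L' : G →* (V ≃ₗᵢ[ℝ] V) :=
    { toFun := fun g => ⟨L g, fun x => by
        have : ‖L g x‖ ^ 2 = ‖x‖ ^ 2 := by rw [hnorm, hnorm, hL]
        exact (pow_left_inj₀ (norm_nonneg _) (norm_nonneg _) two_ne_zero).1 this⟩
      map_one' := by ext x; simp
      map_mul' := fun g h => by ext x; simp }
  have hL' : ∀ g x, L' g x = L g x := fun g x => rfl
  have h := bieb L' c (fun g h => by rw [hc, hL']) (Real.sqrt d)
    (fun x => by
      obtain ⟨g, hg⟩ := hd x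
      exact ⟨g, Real.le_sqrt_of_sq_le (by rw [hnorm]; exact hg)⟩)
    (fun R => (hfin (R ^ 2)).subset fun g hg => by
      have hg' : ‖c g‖ ≤ R := hg
      change F (c g) (c g) ≤ R ^ 2
      rw [← hnorm]; gcongr)
  have hk : L'.ker = L.ker := by
    ext g
    simp only [MonoidHom.mem_ker]
    constructor
    · intro hg; ext1 x; rw [← hL', hg]; rfl
    · intro hg; ext1 x; rw [hL', hg]; rfl
  rwa [hk] at h

/-- Coordinate functional. -/
abbrev cx (i : Fin 4) : (Fin 4 → ℝ) →ₗ[ℝ] ℝ := LinearMap.proj i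

/-- Polar form of the Lorentz form. -/
noncomputable def polB : (Fin 4 → ℝ) →ₗ[ℝ] (Fin 4 → ℝ) →ₗ[ℝ] ℝ :=
  (cx 0).smulRight (cx 0) + (cx 1).smulRight (cx 1) + (cx 2).smulRight (cx 2)
    - (cx 3).smulRight (cx 3)

theorem polB_apply (x y : Fin 4 → ℝ) :
    polB x y = x 0 * y 0 + x 1 * y 1 + x 2 * y 2 - x 3 * y 3 := by
  simp [polB, cx]

/-- Positive definite form associated with a timelike vector. -/
noncomputable def posF (v : Fin 4 → ℝ) : (Fin 4 → ℝ) →ₗ[ℝ] (Fin 4 → ℝ) →ₗ[ℝ] ℝ :=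
  polB + (2 / (-polB v v)) • (polB v).smulRight (polB v)

theorem posF_apply (v x y : Fin 4 → ℝ) :
    posF v x y = polB x y + 2 / (-polB v v) * (polB v x * polB v y) := by
  simp [posF]

theorem posF_pos (v : Fin 4 → ℝ) (hv : polB v v < 0) (x : Fin 4 → ℝ) (hx : x ≠ 0) :
    0 < posF v x x := by
  rw [posF_apply]
  set D := -polB v v with hD
  have hDp : 0 < D := by linarith
  have key : 0 < D * polB x x + 2 * (polB v x * polB v x) := by
    rw [hD]
    simp only [polB_apply] at hv ⊢
    generalize v 0 = a at *
    generalize v 1 = b at *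
    generalize v 2 = e at *
    generalize v 3 = s at *
    have hx' : 0 < x 0 ^ 2 + x 1 ^ 2 + x 2 ^ 2 + x 3 ^ 2 := by
      by_contra hcon
      apply hx
      funext i
      have h0 := sq_nonneg (x 0)
      have h1 := sq_nonneg (x 1)
      have h2 := sq_nonneg (x 2)
      have h3 := sq_nonneg (x 3)
      fin_cases i
      · exact pow_eq_zero_iff two_ne_zero |>.1 (by linarith : x 0 ^ 2 = 0)
      · exact pow_eq_zero_iff two_ne_zero |>.1 (by linarith : x 1 ^ 2 = 0)
      · exact pow_eq_zero_iff two_ne_zero |>.1 (by linarith : x 2 ^ 2 = 0)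
      · exact pow_eq_zero_iff two_ne_zero |>.1 (by linarith : x 3 ^ 2 = 0)
    generalize x 0 = p at *
    generalize x 1 = q at *
    generalize x 2 = r at *
    generalize x 3 = t at *
    have cs : (p * a + q * b + r * e) ^ 2 ≤ (p^2+q^2+r^2) * (a^2+b^2+e^2) := by
      nlinarith [sq_nonneg (p*b-q*a), sq_nonneg (p*e-r*a), sq_nonneg (q*e-r*b)]
    set X := p^2+q^2+r^2 with hX
    set N := a^2+b^2+e^2 with hN
    set I := p * a + q * b + r * e with hI
    have hXn : 0 ≤ X := by positivity
    have hNn : 0 ≤ N := by positivity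
    have e1 : -(a * a + b * b + e * e - s * s) * (p * p + q * q + r * r - t * t) +
      2 * ((a * p + b * q + e * r - s * t) * (a * p + b * q + e * r - s * t))
      = (s^2 - N) * (X - t^2) + 2 * (I - s*t)^2 := by rw [hX, hN, hI]; ring
    rw [e1]
    have hsN : 0 < s^2 - N := by rw [hN]; linarith
    have hXt : 0 < X + t^2 := by linarith
    clear_value X N I
    clear e1 hx hv hx'
    have hM : 0 < N + s ^ 2 := by linarith
    have e2 : (N + s ^ 2) * ((s^2 - N) * (X - t^2) + 2 * (I - s*t)^2)
      = ((N + s ^ 2) * t - 2 * I * s) ^ 2 + (s ^ 2 - N) * (2 * (X * N - I ^ 2))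
        + (s ^ 2 - N) ^ 2 * X := by ring
    refine pos_of_mul_pos_right (b := _) (a := N + s ^ 2) ?_ hM.le
    rw [e2]
    have h1 : 0 ≤ (s ^ 2 - N) * (2 * (X * N - I ^ 2)) :=
      mul_nonneg hsN.le (by linarith)
    rcases hXn.eq_or_lt with h0 | h0
    · have hI0 : I = 0 := by
        rw [← h0] at cs
        exact pow_eq_zero_iff two_ne_zero |>.1 (le_antisymm (by linarith) (sq_nonneg I))
      have ht : 0 < t ^ 2 := by linarith
      have h2 : ((N + s ^ 2) * t - 2 * I * s) ^ 2 = (N + s ^ 2) ^ 2 * t ^ 2 := by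
        rw [hI0]; ring
      rw [h2]
      have : 0 ≤ (s ^ 2 - N) ^ 2 * X := by positivity
      have : 0 < (N + s ^ 2) ^ 2 * t ^ 2 := by positivity
      linarith
    · have : 0 < (s ^ 2 - N) ^ 2 * X := by positivity
      nlinarith [sq_nonneg ((N + s ^ 2) * t - 2 * I * s)]
  have : polB x x + 2 / D * (polB v x * polB v x)
      = (D * polB x x + 2 * (polB v x * polB v x)) / D := by field_simp
  rw [this]; positivity


/-- If `Γ ≤ E(3,1)` acts freely, properly discontinuously and cocompactly on `ℝ^4` and
contains a central nontrivial pure translation by a timelike vector `v` (`Q(v) < 0`),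
then `Γ` has a finite-index subgroup consisting of pure translations; in particular
`ℝ^4/Γ` is finitely covered by a torus `T^4`. -/
theorem statement9 (Γ : Subgroup (AffGroup (2 + 2)))
    (hLor : ∀ γ ∈ Γ, ∀ v : Vec (2 + 2), lorentzQ 2 (γ.linear v) = lorentzQ 2 v)
    (hFree : FreeAction Γ) (hPD : ProperlyDisc Γ) (hCC : CocompactAction Γ)
    (τ : AffGroup (2 + 2)) (hτΓ : τ ∈ Γ) (v : Vec (2 + 2)) (hvne : v ≠ 0)
    (hτv : ∀ x : Vec (2 + 2), τ x = x + v) (hTimelike : lorentzQ 2 v < 0)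
    (hCentral : ∀ γ ∈ Γ, γ * τ = τ * γ) :
    ∃ H : Subgroup ↥Γ, H.FiniteIndex ∧
      ∀ γ ∈ H, ∃ a : Vec (2 + 2), ∀ x : Vec (2 + 2), (γ : AffGroup (2 + 2)) x = x + a := by
  have hQ : ∀ x : Vec (2 + 2), lorentzQ 2 x = polB x x := by
    intro x
    rw [polB_apply, lorentzQ, Fin.sum_univ_three]
    change x 0 ^ 2 + x 1 ^ 2 + x 2 ^ 2 - x 3 ^ 2 = _
    ring
  have hpsymm : ∀ x y, polB x y = polB y x := by
    intro x y; rw [polB_apply, polB_apply]; ring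
  have hQQ : ∀ γ ∈ Γ, ∀ x y : Vec (2 + 2), polB (γ.linear x) (γ.linear y) = polB x y := by
    intro γ hγ x y
    have h1 := hLor γ hγ (x + y)
    have h2 := hLor γ hγ x
    have h3 := hLor γ hγ y
    rw [hQ, hQ] at h1 h2 h3
    simp only [map_add, LinearMap.add_apply] at h1
    have h4 := hpsymm x y
    have h5 := hpsymm (γ.linear x) (γ.linear y)
    linarith
  have haff : ∀ (γ : AffGroup (2 + 2)) (x y : Vec (2 + 2)), γ (x + y) = γ.linear x + γ y := by
    intro γ x y
    simpa using γ.map_vadd y x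
  have hfix : ∀ γ ∈ Γ, γ.linear v = v := by
    intro γ hγ
    have h1 : γ (τ 0) = τ (γ 0) := congrArg (fun g : AffGroup (2 + 2) => g 0) (hCentral γ hγ)
    rw [hτv, hτv, zero_add] at h1
    have h2 := haff γ v 0
    rw [add_zero, h1, add_comm (γ.linear v) (γ 0)] at h2
    exact (add_left_cancel h2).symm
  have hv : polB v v < 0 := by rw [← hQ]; exact hTimelike
  have hF : ∀ γ ∈ Γ, ∀ x y : Vec (2 + 2),
      posF v (γ.linear x) (γ.linear y) = posF v x y := by
    intro γ hγ x y
    have h1 := hQQ γ hγ v x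
    have h2 := hQQ γ hγ v y
    rw [hfix γ hγ] at h1 h2
    rw [posF_apply, posF_apply, hQQ γ hγ, h1, h2]
  have hcont : Continuous fun x : Vec (2 + 2) => posF v x x := by
    simp only [posF_apply, polB_apply]
    fun_prop
  let L : ↥Γ →* (Vec (2 + 2) ≃ₗ[ℝ] Vec (2 + 2)) :=
    (AffineEquiv.linearHom : AffGroup (2 + 2) →* _).comp Γ.subtype
  have hL : ∀ (g : ↥Γ) x, L g x = (g : AffGroup (2 + 2)).linear x := fun g x => rfl
  obtain ⟨K, hK, hKc⟩ := hCC
  obtain ⟨d, hd⟩ := (hK.image hcont).bddAbove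
  obtain ⟨ε, hε, hεb⟩ : ∃ ε : ℝ, 0 < ε ∧ ∀ x : Vec (2 + 2), ε * ‖x‖ ^ 2 ≤ posF v x x := by
    have hne : (Metric.sphere (0 : Vec (2 + 2)) 1).Nonempty :=
      NormedSpace.sphere_nonempty.2 zero_le_one
    obtain ⟨u, hu, hmin⟩ := (isCompact_sphere (0 : Vec (2 + 2)) 1).exists_isMinOn hne
      hcont.continuousOn
    have hu0 : u ≠ 0 := by rintro rfl; simp at hu
    refine ⟨posF v u u, posF_pos v hv u hu0, fun x => ?_⟩
    by_cases hx : x = 0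
    · simp [hx]
    have hxp : 0 < ‖x‖ := norm_pos_iff.2 hx
    have h1 : posF v u u ≤ posF v (‖x‖⁻¹ • x) (‖x‖⁻¹ • x) :=
      hmin (a := ‖x‖⁻¹ • x) (by simp [norm_smul, hx])
    simp only [map_smul, LinearMap.smul_apply, smul_eq_mul] at h1
    calc posF v u u * ‖x‖ ^ 2 ≤ (‖x‖⁻¹ * (‖x‖⁻¹ * posF v x x)) * ‖x‖ ^ 2 := by gcongr
      _ = posF v x x := by field_simp
  have hfi : L.ker.FiniteIndex := by
    refine bieb_form (posF v) ?_ (posF_pos v hv) L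
      (fun g => (g : AffGroup (2 + 2)) 0) ?_ ?_ d ?_ ?_
    · intro x y
      rw [posF_apply, posF_apply, hpsymm x y]; ring
    · intro g x y
      exact hF g g.2 x y
    · intro g h
      have := haff g ((h : AffGroup (2 + 2)) 0) 0
      rw [add_zero] at this
      rw [hL]
      exact this.trans (add_comm _ _)
    · intro x
      obtain ⟨γ, hγ, hx⟩ := hKc x
      refine ⟨⟨γ⁻¹, Γ.inv_mem hγ⟩, ?_⟩
      change posF v (γ⁻¹ 0 - x) (γ⁻¹ 0 - x) ≤ d
      have h1 := haff γ (γ⁻¹ 0 - x) x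
      rw [sub_add_cancel] at h1
      have h2 : γ (γ⁻¹ 0) = 0 := γ.apply_symm_apply 0
      rw [h2] at h1
      have h3 : γ.linear (γ⁻¹ 0 - x) = -γ x := eq_neg_of_add_eq_zero_left h1.symm
      rw [← hF γ hγ, h3]
      simp only [map_neg, LinearMap.neg_apply, neg_neg]
      exact hd ⟨γ x, hx, rfl⟩
    · intro R
      have hfin := hPD (Metric.closedBall 0 (Real.sqrt (R / ε))) (isCompact_closedBall _ _)
      refine Set.Finite.subset (hfin.preimage (f := fun g : ↥Γ => (g : AffGroup (2 + 2)))
        Subtype.val_injective.injOn) ?_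
      intro g hg
      have hg' : posF v ((g : AffGroup (2 + 2)) 0) ((g : AffGroup (2 + 2)) 0) ≤ R := hg
      refine ⟨g.2, (g : AffGroup (2 + 2)) 0, ⟨0, ?_, rfl⟩, ?_⟩
      · simp
      · rw [mem_closedBall_zero_iff]
        apply Real.le_sqrt_of_sq_le
        rw [le_div_iff₀ hε, mul_comm]
        exact (hεb _).trans hg'
  refine ⟨L.ker, hfi, fun γ hγ => ⟨(γ : AffGroup (2 + 2)) 0, fun x => ?_⟩⟩
  have h1 := haff γ x 0
  rw [add_zero, ← hL, MonoidHom.mem_ker.1 hγ] at h1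
  exact h1
end
end
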